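/- arXiv:2006.16613 — 11 statements merged into one kernel-verified Lean document; each statement's English description precedes it below -/
import Mathlib

section
/- For every n ≥ 1 non-atomic Borel probability measures μ₁, …, μₙ on the interval [0,1] and every integer k ≥ 2, there exist points 0 = t₀ ≤ t₁ ≤ … ≤ t_N = 1 with N ≤ n(k−1)+1 and an assignment f : {1,…,N} → {1,…,k} of the subintervals [t_{j−1}, t_j] to the k agents such that for every agent a ∈ {1,…,k} and every measure i ∈ {1,…,n}, the union U_a = ⋃_{j : f(j)=a} [t_{j−1}, t_j] satisfies μ_i(U_a) ≥ 1/(kn). (That is, at most n(k−1) cuts of [0,1] suffice to give every one of k agents at least 1/(kn) of each of the n measures.) -/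
open MeasureTheory Set

/-- Cut greedily from the left: each new piece ends where some measure that labels fewer than `r`
pieces so far first collects `δ`; the piece is labelled by that measure. -/
lemma exists_greedy_cuts {ι : Type*} [Fintype ι] [Nonempty ι] [DecidableEq ι]
    (F : ι → ℝ → ℝ)
    (hc : ∀ i, Continuous (F i)) (hm : ∀ i, Monotone (F i)) (h0 : ∀ i, F i 0 = 0)
    (h1 : ∀ i, F i 1 = 1) (r : ℕ) (δ : ℝ) (hδ : 0 < δ)
    (hle : ((Fintype.card ι * r : ℕ) : ℝ) * δ ≤ 1) (m : ℕ) (hmle : m ≤ Fintype.card ι * r) :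
    ∃ (t : ℕ → ℝ) (l : ℕ → ι), (∀ j < m, t j ≤ t (j + 1)) ∧ t 0 = 0 ∧ t m ≤ 1 ∧
      (∀ j < m, F (l j) (t (j + 1)) - F (l j) (t j) = δ) ∧
      (∀ i, ((Finset.range m).filter (fun j => l j = i)).card ≤ r) ∧
      (∀ j < m, ∀ i, ((Finset.range j).filter (fun j => l j = i)).card < r →
        F i (t (j + 1)) - F i (t j) ≤ δ) := by
  induction m with
  | zero =>
    exact ⟨fun _ => 0, fun _ => Classical.arbitrary ι,
      by simp, rfl, by simp, by simp, by simp, by simp⟩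
  | succ m ih =>
    obtain ⟨t, l, ht, ht0, htm, hl, hcard, hact⟩ := ih (by omega)
    have hbound : ∀ i, ((Finset.range m).filter (fun j => l j = i)).card < r →
        F i (t m) ≤ m * δ := by
      intro i hi
      have : ∑ j ∈ Finset.range m, (F i (t (j + 1)) - F i (t j)) ≤
          ∑ j ∈ Finset.range m, δ := by
        refine Finset.sum_le_sum fun j hj => ?_
        rw [Finset.mem_range] at hj
        refine hact j hj i (lt_of_le_of_lt (Finset.card_le_card ?_) hi)
        exact Finset.filter_subset_filter _ (Finset.range_mono hj.le)
      rw [Finset.sum_range_sub (fun j => F i (t j))] at this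
      simpa [ht0, h0] using this
    set A : Finset ι := Finset.univ.filter
      (fun i => ((Finset.range m).filter (fun j => l j = i)).card < r) with hA
    have hAne : A.Nonempty := by
      by_contra hne
      have hall : ∀ i, r ≤ ((Finset.range m).filter (fun j => l j = i)).card := by
        intro i
        by_contra hi
        exact hne ⟨i, by simp [hA]; omega⟩
      have hs := Finset.card_eq_sum_card_fiberwise (s := Finset.range m)
        (t := (Finset.univ : Finset ι)) (f := l) (fun _ _ => by simp)
      have h2 : ∑ _i : ι, r ≤ ∑ i : ι, ((Finset.range m).filter (fun j => l j = i)).card :=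
        Finset.sum_le_sum fun i _ => hall i
      rw [← hs] at h2
      simp at h2
      omega
    have hex : ∀ i, ∃ s, i ∈ A → t m ≤ s ∧ s ≤ 1 ∧ F i s = F i (t m) + δ := by
      intro i
      by_cases hi : i ∈ A
      · have hb := hbound i (by simpa [hA] using hi)
        have hm1 : ((m + 1 : ℕ) : ℝ) * δ ≤ 1 :=
          le_trans (mul_le_mul_of_nonneg_right (by exact_mod_cast hmle) hδ.le) hle
        push_cast at hm1
        obtain ⟨s, hs, hs'⟩ := intermediate_value_Icc htm (hc i).continuousOn
          (show F i (t m) + δ ∈ Icc (F i (t m)) (F i 1) by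
            rw [h1]; constructor <;> linarith)
        exact ⟨s, fun _ => ⟨hs.1, hs.2, hs'⟩⟩
      · exact ⟨0, fun h => absurd h hi⟩
    choose s hs using hex
    obtain ⟨i, hiA, hmin⟩ := Finset.exists_min_image A s hAne
    have hcount : ∀ j ≤ m, ∀ i', ((Finset.range j).filter
        (fun j => (if j < m then l j else i) = i')) =
        (Finset.range j).filter (fun j => l j = i') := by
      intro j hj i'
      refine Finset.filter_congr fun x hx => ?_
      rw [Finset.mem_range] at hx
      rw [if_pos (by omega)]
    refine ⟨fun j => if j ≤ m then t j else s i, fun j => if j < m then l j else i,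
      ?_, ?_, ?_, ?_, ?_, ?_⟩
    · intro j hj
      rcases Nat.lt_succ_iff_lt_or_eq.1 hj with h | rfl
      · simpa [h.le, Nat.succ_le_of_lt h] using ht j h
      · simpa using (hs i hiA).1
    · simpa using ht0
    · simpa using (hs i hiA).2.1
    · intro j hj
      rcases Nat.lt_succ_iff_lt_or_eq.1 hj with h | rfl
      · simpa [h, h.le, Nat.succ_le_of_lt h] using hl j h
      · simp [(hs i hiA).2.2]
    · intro i'
      rw [Finset.range_add_one, Finset.filter_insert, hcount m le_rfl]
      by_cases h : i = i'
      · subst h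
        have : ((Finset.range m).filter (fun j => l j = i)).card < r := by
          simpa [hA] using hiA
        simp only [lt_irrefl, if_false, if_true]
        exact (Finset.card_insert_le _ _).trans this
      · simpa [h] using hcard i'
    · intro j hj i' hi'
      rw [hcount j (by omega)] at hi'
      rcases Nat.lt_succ_iff_lt_or_eq.1 hj with h | rfl
      · simpa [h, h.le, Nat.succ_le_of_lt h] using hact j h i' hi'
      · have hi'A : i' ∈ A := by simpa [hA] using hi'
        have := hm i' (hmin i' hi'A)
        rw [(hs i' hi'A).2.2] at this
        simp only [le_refl, if_true, Nat.not_succ_le_self, if_false]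
        linarith

/-- The greedy cuts satisfy an expansion condition: every nonempty set of measures has a member
with a `δ`-heavy piece that is not labelled from the set (the last piece being unlabelled). -/
lemma exists_expanding_cuts {ι : Type*} [Fintype ι] [Nonempty ι] [DecidableEq ι]
    (F : ι → ℝ → ℝ)
    (hc : ∀ i, Continuous (F i)) (hm : ∀ i, Monotone (F i)) (h0 : ∀ i, F i 0 = 0)
    (h1 : ∀ i, F i 1 = 1) (r : ℕ) (hr : 0 < r) (δ : ℝ) (hδ : 0 < δ) (M : ℕ)
    (hM : M = Fintype.card ι * r) (hle : ((M : ℝ) + 1) * δ ≤ 1) :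
    ∃ (t : ℕ → ℝ) (l : ℕ → ι), (∀ j ≤ M, t j ≤ t (j + 1)) ∧ t 0 = 0 ∧ t (M + 1) = 1 ∧
      (∀ i, ((Finset.range M).filter (fun j => l j = i)).card = r) ∧
      (∀ j < M, δ ≤ F (l j) (t (j + 1)) - F (l j) (t j)) ∧
      (∀ I : Finset ι, I.Nonempty → ∃ i ∈ I, ∃ p ≤ M, (p < M → l p ∉ I) ∧
        δ ≤ F i (t (p + 1)) - F i (t p)) := by
  obtain ⟨t₀, l, ht, ht0, htm, hl, hcard, hact⟩ := exists_greedy_cuts F hc hm h0 h1 r δ hδ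
    (by rw [← hM]; nlinarith) M hM.le
  obtain ⟨t, htdef⟩ : ∃ t : ℕ → ℝ, t = fun j => if j ≤ M then t₀ j else 1 := ⟨_, rfl⟩
  have hte : ∀ j ≤ M, t j = t₀ j := fun j hj => by simp [htdef, hj]
  have htl : t (M + 1) = 1 := by simp [htdef]
  have hcardeq : ∀ i, ((Finset.range M).filter (fun j => l j = i)).card = r := by
    have hs := Finset.card_eq_sum_card_fiberwise (s := Finset.range M)
      (t := (Finset.univ : Finset ι)) (f := l) (fun _ _ => by simp)
    have h2 : ∑ i : ι, ((Finset.range M).filter (fun j => l j = i)).card = ∑ _i : ι, r := by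
      rw [← hs]; simp [hM]
    intro i
    exact (Finset.sum_eq_sum_iff_of_le (fun i _ => hcard i)).1 h2 i (Finset.mem_univ i)
  refine ⟨t, l, ?_, ?_, htl, hcardeq, ?_, ?_⟩
  · intro j hj
    rcases hj.lt_or_eq with h | rfl
    · rw [hte j hj, hte _ h]; exact ht j h
    · rw [hte j le_rfl, htl]; exact htm
  · rw [hte 0 (Nat.zero_le _), ht0]
  · intro j hj
    rw [hte j hj.le, hte _ hj, hl j hj]
  · rintro I ⟨i₀, hi₀⟩
    by_contra! hcon
    have hne : ((Finset.range M).filter (fun j => l j ∈ I)).Nonempty := by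
      have : ((Finset.range M).filter (fun j => l j = i₀)).Nonempty := by
        rw [← Finset.card_pos, hcardeq]; exact hr
      obtain ⟨j, hj⟩ := this
      rw [Finset.mem_filter] at hj
      exact ⟨j, Finset.mem_filter.2 ⟨hj.1, hj.2 ▸ hi₀⟩⟩
    obtain ⟨q, hq, hmax⟩ := Finset.exists_max_image _ id hne
    rw [Finset.mem_filter, Finset.mem_range] at hq
    have hlast : F (l q) (t (M + 1)) - F (l q) (t M) < δ :=
      hcon _ hq.2 M le_rfl (by simp)
    have hsum : ∑ j ∈ Finset.range M, (F (l q) (t (j + 1)) - F (l q) (t j)) ≤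
        ∑ j ∈ Finset.range M, δ := by
      refine Finset.sum_le_sum fun j hj => ?_
      have hjM := Finset.mem_range.1 hj
      by_cases hjq : j ≤ q
      · rw [hte j hjM.le, hte _ hjM]
        refine hact j hjM _ ?_
        rw [← hcardeq (l q)]
        refine Finset.card_lt_card (Finset.ssubset_iff_of_subset ?_ |>.2 ⟨q, ?_, ?_⟩)
        · exact Finset.filter_subset_filter _ (Finset.range_mono hjM.le)
        · simp [hq.1]
        · simp [hjq]
      · refine (hcon _ hq.2 j hjM.le fun _ hjI => hjq ?_).le
        exact hmax j (Finset.mem_filter.2 ⟨hj, hjI⟩)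
    rw [Finset.sum_range_sub (fun j => F (l q) (t j)), hte 0 (Nat.zero_le _), ht0, h0] at hsum
    rw [htl, h1] at hlast
    simp at hsum
    linarith

/-- If every measure labels `r` heavy pieces and the expansion condition holds, then the pieces
can be coloured with `r + 1` colours so that every measure has a heavy piece of each colour. -/
lemma exists_coloring_of_expanding {ι : Type*} [Fintype ι] [DecidableEq ι] (H : ι → ℕ → Prop)
    (r M : ℕ) (l : ℕ → ι)
    (hcard : ∀ i, ((Finset.range M).filter (fun j => l j = i)).card = r)
    (hl : ∀ j < M, H (l j) j)
    (hexp : ∀ I : Finset ι, I.Nonempty → ∃ i ∈ I, ∃ p ≤ M, (p < M → l p ∉ I) ∧ H i p) :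
    ∃ f : ℕ → Fin (r + 1), ∀ i c, ∃ p ≤ M, f p = c ∧ H i p := by
  let P : Finset ι → Prop := fun I => ∃ f : ℕ → Fin (r + 1), ∀ i ∉ I, ∀ c, ∃ p ≤ M,
    (p < M → l p ∉ I) ∧ f p = c ∧ H i p
  have hstep : ∀ I, P I → I.Nonempty → ∃ i ∈ I, P (I.erase i) := by
    rintro I ⟨f, hf⟩ hI
    obtain ⟨i, hi, p, hpM, hpI, hp⟩ := hexp I hI
    refine ⟨i, hi, ?_⟩
    let L := (Finset.range M).filter (fun j => l j = i)
    have hLI : ∀ q, (q < M → l q ∉ I) → q ∉ L := by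
      intro q hq hqL
      obtain ⟨h1, h2⟩ := Finset.mem_filter.1 hqL
      exact hq (Finset.mem_range.1 h1) (h2 ▸ hi)
    have hcardL : L.card = (Finset.univ.erase (f p)).card := by
      simp [L, hcard]
    let e := Finset.equivOfCardEq hcardL
    refine ⟨fun j => if h : j ∈ L then (e ⟨j, h⟩ : Fin (r + 1)) else f j, fun i' hi' c => ?_⟩
    by_cases hii : i' = i
    · subst hii
      by_cases hc : c = f p
      · refine ⟨p, hpM, fun h h' => hpI h (Finset.mem_of_mem_erase h'), ?_, hp⟩
        beta_reduce
        rw [dif_neg (hLI p hpI), hc]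
      · obtain ⟨⟨q, hq⟩, hqe⟩ := e.surjective ⟨c, by simp [hc]⟩
        obtain ⟨h1, h2⟩ := Finset.mem_filter.1 hq
        refine ⟨q, (Finset.mem_range.1 h1).le, fun _ => by simp [h2], ?_, ?_⟩
        · beta_reduce
          rw [dif_pos hq, hqe]
        · have := hl q (Finset.mem_range.1 h1)
          rwa [h2] at this
    · obtain ⟨q, hqM, hqI, hqc, hq⟩ := hf i' (fun h => hi' (Finset.mem_erase.2 ⟨hii, h⟩)) c
      refine ⟨q, hqM, fun h h' => hqI h (Finset.mem_of_mem_erase h'), ?_, hq⟩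
      beta_reduce
      rw [dif_neg (hLI q hqI), hqc]
  have hdesc : ∀ I, P I → P ∅ := by
    intro I
    induction I using Finset.strongInduction with
    | H I ih =>
      intro hI
      rcases I.eq_empty_or_nonempty with rfl | hne
      · exact hI
      · obtain ⟨i, hi, hPi⟩ := hstep I hI hne
        exact ih _ (Finset.erase_ssubset hi) hPi
  obtain ⟨f, hf⟩ := hdesc Finset.univ ⟨fun _ => 0, by simp⟩
  refine ⟨f, fun i c => ?_⟩
  obtain ⟨p, hp, -, hp'⟩ := hf i (by simp) c
  exact ⟨p, hp, hp'⟩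

lemma continuous_cdf_of_singleton_null (ν : Measure ℝ) [IsProbabilityMeasure ν]
    (hna : ∀ x : ℝ, ν {x} = 0) : Continuous (ProbabilityTheory.cdf ν) := by
  refine continuous_iff_continuousAt.2 fun x => ?_
  have hmono := ProbabilityTheory.monotone_cdf ν
  rw [hmono.continuousAt_iff_leftLim_eq_rightLim, StieltjesFunction.rightLim_eq]
  refine le_antisymm (hmono.leftLim_le le_rfl) ?_
  have := hna x
  rw [← ProbabilityTheory.measure_cdf ν, StieltjesFunction.measure_singleton,
    ENNReal.ofReal_eq_zero] at this
  linarith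

lemma measure_Ioc_eq_cdf_sub (ν : Measure ℝ) [IsProbabilityMeasure ν] (a b : ℝ) :
    ν (Ioc a b) = ENNReal.ofReal (ProbabilityTheory.cdf ν b - ProbabilityTheory.cdf ν a) := by
  conv_lhs => rw [← ProbabilityTheory.measure_cdf ν]
  exact StieltjesFunction.measure_Ioc _ a b

lemma cdf_endpoints_of_unit_support (ν : Measure ℝ) [IsProbabilityMeasure ν]
    (hsupp : ν (Icc (0 : ℝ) 1) = 1) (hna : ∀ x : ℝ, ν {x} = 0) :
    ProbabilityTheory.cdf ν 0 = 0 ∧ ProbabilityTheory.cdf ν 1 = 1 := by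
  have : NullSingletonClass ν := ⟨hna⟩
  have h := measure_Ioc_eq_cdf_sub ν 0 1
  rw [measure_congr Ioc_ae_eq_Icc, hsupp, eq_comm, ENNReal.ofReal_eq_one] at h
  have h0 := ProbabilityTheory.cdf_nonneg ν 0
  have h1 := ProbabilityTheory.cdf_le_one ν 1
  constructor <;> linarith

theorem positive_share_with_few_cuts
    (n k : ℕ) (hn : 1 ≤ n) (hk : 2 ≤ k)
    (μ : Fin n → Measure ℝ)
    (hprob : ∀ i, IsProbabilityMeasure (μ i))
    (hsupp : ∀ i, μ i (Set.Icc (0 : ℝ) 1) = 1)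
    (hna : ∀ i (x : ℝ), μ i {x} = 0) :
    ∃ N : ℕ, N ≤ n * (k - 1) + 1 ∧
      ∃ t : Fin (N + 1) → ℝ, Monotone t ∧ t 0 = 0 ∧ t (Fin.last N) = 1 ∧
        ∃ f : Fin N → Fin k,
          ∀ (a : Fin k) (i : Fin n),
            μ i (⋃ j ∈ {j : Fin N | f j = a}, Set.Icc (t j.castSucc) (t j.succ))
              ≥ 1 / ((k : ENNReal) * (n : ENNReal)) := by
  obtain ⟨r, rfl⟩ : ∃ r, k = r + 1 := ⟨k - 1, by omega⟩
  have : Nonempty (Fin n) := ⟨⟨0, hn⟩⟩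
  have hn' : (1 : ℝ) ≤ n := by exact_mod_cast hn
  have hends := fun i => cdf_endpoints_of_unit_support (μ i) (hsupp i) (hna i)
  obtain ⟨t, l, ht, ht0, htl, hcard, hl, hexp⟩ := exists_expanding_cuts
    (fun i => ProbabilityTheory.cdf (μ i))
    (fun i => continuous_cdf_of_singleton_null (μ i) (hna i))
    (fun i => ProbabilityTheory.monotone_cdf (μ i)) (fun i => (hends i).1) (fun i => (hends i).2)
    r (by omega) (1 / (((r + 1 : ℕ) : ℝ) * n)) (by positivity) (n * r) (by simp) (by
      rw [mul_one_div, div_le_one (by positivity)]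
      push_cast
      nlinarith)
  obtain ⟨f, hf⟩ := exists_coloring_of_expanding
    (fun i p => 1 / (((r + 1 : ℕ) : ℝ) * n) ≤
      ProbabilityTheory.cdf (μ i) (t (p + 1)) - ProbabilityTheory.cdf (μ i) (t p))
    r (n * r) l hcard hl hexp
  refine ⟨n * r + 1, by simp, fun j => t j, ?_, by simpa using ht0, by simpa using htl,
    fun j => f j, fun a i => ?_⟩
  · refine Fin.monotone_iff_le_succ.2 fun j => ?_
    simpa using ht j (by omega)
  · obtain ⟨p, hp, hpa, hpH⟩ := hf i a
    calc 1 / (((r + 1 : ℕ) : ENNReal) * (n : ENNReal))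
        = ENNReal.ofReal (1 / (((r + 1 : ℕ) : ℝ) * n)) := by
          rw [ENNReal.ofReal_div_of_pos (by positivity), ENNReal.ofReal_one,
            ENNReal.ofReal_mul (by positivity), ENNReal.ofReal_natCast, ENNReal.ofReal_natCast]
      _ ≤ μ i (Ioc (t p) (t (p + 1))) := by
          rw [measure_Ioc_eq_cdf_sub]
          exact ENNReal.ofReal_le_ofReal hpH
      _ ≤ _ := by
          refine measure_mono (Ioc_subset_Icc_self.trans ?_)
          exact subset_biUnion_of_mem (s := {j : Fin (n * r + 1) | f j = a})
            (u := fun j : Fin (n * r + 1) => Icc (t j.castSucc) (t j.succ))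
            (x := ⟨p, Nat.lt_succ_of_le hp⟩) hpa
end

section
/- Let n, k ≥ 1 and let c : {0, 1, …, kn−1} → {1, …, n} be a coloring of kn beads arranged on a line such that each color appears exactly k times. Then there exists a partition of {0, 1, …, kn−1} into at most n(k−1)+1 intervals of consecutive integers together with an assignment of these intervals to k agents, such that for every agent a ∈ {1,…,k} and every color i ∈ {1,…,n}, the union of the intervals assigned to agent a contains exactly one bead of color i. -/
/-- Some assignment of beads to agents gives same-colored beads to distinct agents. -/
theorem exists_agents_injOn_color {n k N : ℕ} (hk : 1 ≤ k) (c : ℕ → Fin n)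
    (hc : ∀ i : Fin n, ((Finset.range N).filter (fun b => c b = i)).card = k) :
    ∃ g : ℕ → Fin k, ∀ x < N, ∀ y < N, c x = c y → g x = g y → x = y := by
  have key : ∀ i : Fin n, ∃ e : ℕ → Fin k,
      Set.InjOn e ((Finset.range N).filter (fun b => c b = i)) := by
    intro i
    let f := Finset.equivFinOfCardEq (hc i)
    refine ⟨fun b => if h : b ∈ (Finset.range N).filter (fun b => c b = i) then f ⟨b, h⟩
      else ⟨0, hk⟩, fun x hx y hy hxy => ?_⟩
    rw [Finset.mem_coe] at hx hy
    simp only [dif_pos hx, dif_pos hy] at hxy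
    simpa using f.injective hxy
  choose e he using key
  refine ⟨fun b => e (c b) b, fun x hx y hy hxy hg => he (c x) ?_ ?_ ?_⟩
  · simp [hx]
  · simp [hy, hxy]
  · simpa only [← hxy] using hg

/-- The assignment can moreover be chosen so that every first occurrence of a color
(other than the very first bead) goes to the same agent as the preceding bead. -/
theorem exists_agents_eq_at_first_occurrence {n k N : ℕ} (hk : 1 ≤ k) (c : ℕ → Fin n)
    (hc : ∀ i : Fin n, ((Finset.range N).filter (fun b => c b = i)).card = k) (m : ℕ) :
    ∃ g : ℕ → Fin k, (∀ x < N, ∀ y < N, c x = c y → g x = g y → x = y) ∧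
      ∀ j < m, (∀ y ≤ j, c y ≠ c (j + 1)) → g j = g (j + 1) := by
  induction m with
  | zero =>
    obtain ⟨g, hg⟩ := exists_agents_injOn_color hk c hc
    exact ⟨g, hg, by simp⟩
  | succ m ih =>
    obtain ⟨g, hg, hfirst⟩ := ih
    by_cases hm : ∀ y ≤ m, c y ≠ c (m + 1)
    · refine ⟨fun b => if c b = c (m + 1) then Equiv.swap (g m) (g (m + 1)) (g b) else g b,
        fun x hx y hy hxy hgxy => hg x hx y hy hxy ?_, fun j hj hj' => ?_⟩
      · by_cases h : c y = c (m + 1)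
        · simpa [hxy, h] using hgxy
        · simpa [hxy, h] using hgxy
      · rcases Nat.lt_succ_iff_lt_or_eq.mp hj with h | rfl
        · simpa [hm j h.le, hm (j + 1) h] using hfirst j h hj'
        · simp [hm j le_rfl]
    · refine ⟨g, hg, fun j hj hj' => ?_⟩
      rcases Nat.lt_succ_iff_lt_or_eq.mp hj with h | rfl
      · exact hfirst j h hj'
      · exact absurd hj' hm

/-- Any necklace of `kn` beads with exactly `k` beads of each of `n` colors can be split,
using at most `n(k-1)` cuts (i.e. into at most `n(k-1)+1` intervals of consecutive beads),
and the intervals distributed to `k` agents so that every agent gets exactly one bead of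
each color. The assignment of beads to agents is recorded by `g`; the number of intervals
is one more than the number of indices where `g` changes. -/
theorem necklace_k_beads_each_color
    (n k : ℕ) (hn : 1 ≤ n) (hk : 1 ≤ k)
    (c : ℕ → Fin n)
    (hc : ∀ i : Fin n, ((Finset.range (k * n)).filter (fun b => c b = i)).card = k) :
    ∃ g : ℕ → Fin k,
      ((Finset.range (k * n - 1)).filter (fun j => g j ≠ g (j + 1))).card + 1
        ≤ n * (k - 1) + 1 ∧
      ∀ (a : Fin k) (i : Fin n),
        ((Finset.range (k * n)).filter (fun b => g b = a ∧ c b = i)).card = 1 := by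
  obtain ⟨g, hg, hfirst⟩ := exists_agents_eq_at_first_occurrence hk c hc (k * n)
  refine ⟨g, ?_, fun a i => ?_⟩
  · have hex : ∀ i : Fin n, ∃ b, b < k * n ∧ c b = i ∧ ∀ y < b, c y ≠ i := by
      intro i
      have hne : ∃ b, b < k * n ∧ c b = i := by
        have hpos : 0 < ((Finset.range (k * n)).filter (fun b => c b = i)).card := by
          rw [hc i]; exact hk
        obtain ⟨b, hb⟩ := Finset.card_pos.mp hpos
        exact ⟨b, by simpa using hb⟩
      classical
      obtain ⟨hlt, hcol⟩ := Nat.find_spec hne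
      exact ⟨Nat.find hne, hlt, hcol, fun y hy hyc => Nat.find_min hne hy ⟨hy.trans hlt, hyc⟩⟩
    choose F hFlt hFc hFmin using hex
    have hFpos : ∀ i ≠ c 0, 0 < F i := fun i hi =>
      Nat.pos_of_ne_zero fun h => hi (by rw [← hFc i, h])
    have hcard : (Finset.univ.erase (c 0)).card ≤
        ((Finset.range (k * n - 1)).filter (fun j => ¬ g j ≠ g (j + 1))).card := by
      refine Finset.card_le_card_of_injOn (fun i => F i - 1) (fun i hi => ?_)
        (fun i hi j hj hij => ?_)
      · have hpos := hFpos i (by simpa using hi)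
        have hsucc : F i - 1 + 1 = F i := by omega
        have hlt := hFlt i
        have heq := hfirst (F i - 1) (by omega) (fun y hy => by
          rw [hsucc, hFc]; exact hFmin i y (by omega))
        simp only [Finset.coe_filter, Finset.mem_range, Set.mem_ofPred_eq, not_not]
        exact ⟨by omega, heq⟩
      · have hi' := hFpos i (by simpa using hi)
        have hj' := hFpos j (by simpa using hj)
        have hF : F i = F j := by dsimp only at hij; omega
        rw [← hFc i, ← hFc j, hF]
    have hsum := Finset.card_filter_add_card_filter_not (s := Finset.range (k * n - 1))
      (fun j => g j ≠ g (j + 1))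
    rw [Finset.card_erase_of_mem (Finset.mem_univ _), Finset.card_univ, Fintype.card_fin] at hcard
    rw [Finset.card_range] at hsum
    have hmul : n * (k - 1) + n = k * n := by
      obtain ⟨k, rfl⟩ := Nat.exists_eq_add_of_le' hk
      simp only [Nat.add_sub_cancel]
      ring
    omega
  · have hinj : Set.InjOn g ((Finset.range (k * n)).filter (fun b => c b = i)) := by
      intro x hx y hy hxy
      simp only [Finset.coe_filter, Finset.mem_range, Set.mem_ofPred_eq] at hx hy
      exact hg x hx.1 y hy.1 (hx.2.trans hy.2.symm) hxy
    have himg : ((Finset.range (k * n)).filter (fun b => c b = i)).image g = Finset.univ := by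
      rw [← Finset.card_eq_iff_eq_univ, Finset.card_image_of_injOn hinj, hc, Fintype.card_fin]
    obtain ⟨b, hb, hba⟩ := Finset.mem_image.mp (himg ▸ Finset.mem_univ a)
    simp only [Finset.mem_filter, Finset.mem_range] at hb
    refine Finset.card_eq_one.mpr ⟨b, Finset.ext fun x => ?_⟩
    simp only [Finset.mem_filter, Finset.mem_range, Finset.mem_singleton]
    constructor
    · rintro ⟨hx, hxa, hxc⟩
      exact hg x hx b hb.1 (hxc.trans hb.2.symm) (hxa.trans hba.symm)
    · rintro rfl
      exact ⟨hb.1, hba, hb.2⟩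
end

section
/- Let n ≥ 1, let μ₁, …, μₙ be non-atomic Borel probability measures on [0,1], and let ε ∈ (0,1). Then there exist points 0 = t₀ ≤ t₁ ≤ … ≤ t_N = 1 with N ≤ n(2 + ⌈log₂(1/ε)⌉) + 1 and a partition of the subintervals [t_{j−1}, t_j] into two collections C₀ and C₁ such that for every measure i ∈ {1,…,n} and each j ∈ {0,1}, the union of the intervals in C_j has μ_i-measure in the interval [1/2 − ε/2, 1/2 + ε/2]. (That is, at most n(2 + ⌈log₂(1/ε)⌉) cuts suffice for ε-Consensus Halving.) -/
open MeasureTheory Set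

/-- A nonzero direction leads from the open cube `(-1, 1)^s` to its boundary. -/
theorem exists_sign_step {ι : Type*} (s : Finset ι) (x y : ι → ℝ) (hx : ∀ a ∈ s, |x a| < 1)
    (hy : ∃ a ∈ s, y a ≠ 0) :
    ∃ c : ℝ, (∀ a ∈ s, |x a + c * y a| ≤ 1) ∧ ∃ a ∈ s, |x a + c * y a| = 1 := by
  classical
  obtain ⟨b, hb, hyb⟩ := hy
  obtain ⟨a, ha, hmin⟩ := (s.filter (y · ≠ 0)).exists_min_image
    (fun a ↦ (SignType.sign (y a) - x a) / y a) ⟨b, by simp [hb, hyb]⟩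
  rw [Finset.mem_filter] at ha
  have hpos : 0 ≤ (SignType.sign (y a) - x a) / y a := by
    have := abs_lt.1 (hx a ha.1)
    rcases lt_or_gt_of_ne ha.2 with h | h
    · rw [sign_neg h, SignType.coe_neg_one]; exact div_nonneg_of_nonpos (by linarith) h.le
    · rw [sign_pos h, SignType.coe_one]; exact div_nonneg (by linarith) h.le
  refine ⟨(SignType.sign (y a) - x a) / y a, fun c hc ↦ ?_, a, ha.1, ?_⟩
  · have h1 := abs_lt.1 (hx c hc)
    rcases lt_trichotomy (y c) 0 with h | h | h
    · have h2 := hmin c (by simp [hc, h.ne])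
      rw [sign_neg h, SignType.coe_neg_one, le_div_iff_of_neg h] at h2
      have := mul_nonpos_of_nonneg_of_nonpos hpos h.le
      rw [abs_le]; constructor <;> linarith
    · simp [h, (hx c hc).le]
    · have h2 := hmin c (by simp [hc, h.ne'])
      rw [sign_pos h, SignType.coe_one, le_div_iff₀ h] at h2
      have := mul_nonneg hpos h.le
      rw [abs_le]; constructor <;> linarith
  · rw [div_mul_cancel₀ _ ha.2]
    rcases lt_or_gt_of_ne ha.2 with h | h
    · simp [sign_neg h]
    · simp [sign_pos h]

/-- A fractional colouring can be modified, keeping the balance of the weights in `A` and all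
colours that are already `±1`, so that at most `#A` elements of `s` stay fractional. -/
theorem exists_coloring_few_fractional {ι κ : Type*} (s : Finset ι) (A : Finset κ)
    (w : κ → ι → ℝ) (x : ι → ℝ) (hx : ∀ a, |x a| ≤ 1) :
    ∃ x' : ι → ℝ, (∀ a, |x' a| ≤ 1) ∧ (∀ a, (a ∈ s → |x a| = 1) → x' a = x a) ∧
      (∀ i ∈ A, ∑ a ∈ s, w i a * x' a = ∑ a ∈ s, w i a * x a) ∧
      (s.filter (|x' ·| ≠ 1)).card ≤ A.card := by
  classical
  induction hm : (s.filter (|x ·| ≠ 1)).card using Nat.strong_induction_on generalizing x with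
  | _ m ih =>
  by_cases hA : (s.filter (|x ·| ≠ 1)).card ≤ A.card
  · exact ⟨x, hx, fun _ _ ↦ rfl, fun _ _ ↦ rfl, hA⟩
  push Not at hA
  set F := s.filter (|x ·| ≠ 1) with hF
  obtain ⟨y, hy, hne⟩ : ∃ y : F → ℝ, (∀ i : A, ∑ a : F, w i a * y a = 0) ∧ y ≠ 0 := by
    let T : (F → ℝ) →ₗ[ℝ] (A → ℝ) := Matrix.mulVecLin (Matrix.of fun i a ↦ w i a)
    have hT : ¬ Function.Injective T := fun h ↦ by
      have := LinearMap.finrank_le_finrank_of_injective h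
      simp at this
      omega
    rw [← LinearMap.ker_eq_bot, Submodule.eq_bot_iff] at hT
    push Not at hT
    obtain ⟨y, hy, h0⟩ := hT
    refine ⟨y, fun i ↦ ?_, h0⟩
    simpa [T, Matrix.mulVec, dotProduct] using congrFun (LinearMap.mem_ker.1 hy) i
  obtain ⟨a₀, ha₀⟩ := Function.ne_iff.1 hne
  let z : ι → ℝ := fun a ↦ if h : a ∈ F then y ⟨a, h⟩ else 0
  have hz : ∀ i ∈ A, ∑ a ∈ s, w i a * z a = 0 := fun i hi ↦ by
    rw [← hy ⟨i, hi⟩, ← Finset.sum_subset (Finset.filter_subset _ _ : F ⊆ s)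
      (fun a _ ha ↦ by rw [show z a = 0 from dif_neg ha, mul_zero]), ← Finset.sum_coe_sort F]
    exact Finset.sum_congr rfl fun a _ ↦ by simp [z]
  obtain ⟨c, hc, a₁, ha₁, hc₁⟩ := exists_sign_step F x z
    (fun a ha ↦ lt_of_le_of_ne (hx a) (Finset.mem_filter.1 ha).2)
    ⟨a₀, a₀.2, by simpa [z] using ha₀⟩
  have hfix : ∀ a, a ∉ F → x a + c * z a = x a := fun a ha ↦ by simp [z, ha]
  have hbd : ∀ a, |x a + c * z a| ≤ 1 := fun a ↦ by
    by_cases ha : a ∈ F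
    · exact hc a ha
    · rw [hfix a ha]; exact hx a
  have hsub : (s.filter fun a ↦ |x a + c * z a| ≠ 1) ⊆ F.erase a₁ := fun a ha ↦ by
    rw [Finset.mem_filter] at ha
    refine Finset.mem_erase.2 ⟨fun h ↦ ha.2 (h ▸ hc₁), ?_⟩
    by_contra h
    rw [hfix a h] at ha
    exact h (Finset.mem_filter.2 ha)
  obtain ⟨x', h1, h2, h3, h4⟩ := ih _
    (((Finset.card_le_card hsub).trans_lt (Finset.card_erase_lt_of_mem ha₁)).trans_eq hm)
    (fun a ↦ x a + c * z a) hbd rfl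
  refine ⟨x', h1, fun a ha ↦ ?_, fun i hi ↦ ?_, h4⟩
  · have haF : a ∉ F := fun h ↦ (Finset.mem_filter.1 h).2 (ha (Finset.mem_filter.1 h).1)
    rw [h2 a fun has ↦ by rw [hfix a haF, ha has], hfix a haF]
  · rw [h3 i hi]
    simp only [mul_add, Finset.sum_add_distrib, mul_left_comm _ c, ← Finset.mul_sum, hz i hi]
    simp

/-- Beck–Fiala rounding: if the total weight of every element is at most `δ`, a fractional colouring
can be rounded to signs while changing every weighted sum by at most `2 * δ`. -/
theorem exists_sign_rounding {ι κ : Type*} (s : Finset ι) (A : Finset κ)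
    (w : κ → ι → ℝ) (hw : ∀ i a, a ∈ s → 0 ≤ w i a) (δ : ℝ)
    (hδ0 : 0 ≤ δ) (hδ : ∀ a ∈ s, ∑ i ∈ A, w i a ≤ δ) (x : ι → ℝ) (hx : ∀ a, |x a| ≤ 1) :
    ∃ x' : ι → ℝ, (∀ a ∈ s, |x' a| = 1) ∧ (∀ a, |x' a| ≤ 1) ∧
      (∀ a, (a ∈ s → |x a| = 1) → x' a = x a) ∧
      ∀ i ∈ A, |∑ a ∈ s, w i a * x' a - ∑ a ∈ s, w i a * x a| ≤ 2 * δ := by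
  classical
  induction hm : A.card generalizing A x with
  | zero =>
    refine ⟨fun a ↦ if a ∈ s ∧ |x a| ≠ 1 then 1 else x a, fun a ha ↦ ?_, fun a ↦ ?_,
      fun a ha ↦ ?_, ?_⟩
    · by_cases h : |x a| = 1 <;> simp [ha, h]
    · dsimp only; split_ifs <;> simp [hx]
    · exact if_neg fun h ↦ h.2 (ha h.1)
    · simp [Finset.card_eq_zero.1 hm]
  | succ m ih =>
    obtain ⟨x₁, h1, h2, h3, h4⟩ := exists_coloring_few_fractional s A w x hx
    set F := s.filter (|x₁ ·| ≠ 1) with hF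
    have hFs : F ⊆ s := Finset.filter_subset _ _
    obtain ⟨i₀, hi₀, hle⟩ : ∃ i ∈ A, ∑ a ∈ F, w i a ≤ δ := by
      have hAne : A.Nonempty := Finset.card_pos.1 (by omega)
      refine Finset.exists_le_of_sum_le hAne ?_
      rw [Finset.sum_comm]
      calc _ ≤ ∑ a ∈ F, δ := Finset.sum_le_sum fun a ha ↦ hδ a (hFs ha)
        _ = F.card * δ := by simp
        _ ≤ A.card * δ := by gcongr
        _ = _ := by simp
    obtain ⟨x', g1, g2, g3, g4⟩ := ih (A.erase i₀) (fun a ha ↦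
      (Finset.sum_le_sum_of_subset_of_nonneg (Finset.erase_subset _ _)
        fun i _ _ ↦ hw i a ha).trans (hδ a ha)) x₁ h1
      (by rw [Finset.card_erase_of_mem hi₀, hm]; rfl)
    refine ⟨x', g1, g2, fun a ha ↦ ?_, fun i hi ↦ ?_⟩
    · rw [g3 a fun has ↦ by rw [h2 a ha, ha has], h2 a ha]
    · rw [← h3 i hi]
      by_cases hii : i = i₀
      · subst hii
        rw [← Finset.sum_sub_distrib, ← Finset.sum_subset hFs]
        · refine (Finset.abs_sum_le_sum_abs _ _).trans
            (le_trans (Finset.sum_le_sum (g := fun a ↦ 2 * w i a) fun a ha ↦ ?_) ?_)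
          · have := abs_le.1 (h1 a)
            have := abs_le.1 (g2 a)
            rw [← mul_sub, abs_mul, abs_of_nonneg (hw i a (hFs ha)), mul_comm]
            refine mul_le_mul_of_nonneg_right (abs_le.2 ⟨?_, ?_⟩) (hw i a (hFs ha)) <;> linarith
          · rw [← Finset.mul_sum]; linarith
        · intro a ha haF
          rw [g3 a fun _ ↦ by_contra fun h ↦ haF (Finset.mem_filter.2 ⟨ha, h⟩), sub_self]
      · exact g4 i (Finset.mem_erase.2 ⟨hii, hi⟩)

/-- A balanced fractional colouring of the dyadic intervals of length `2⁻ᵏ` in `[0, n]` with at most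
`n` fractional intervals and at most `n + n * k` intervals that are fractional or followed by a
different colour. -/
theorem exists_dyadic_coloring (n k : ℕ) (h : Fin n → ℝ → ℝ) :
    ∃ x : ℕ → ℝ, (∀ a, |x a| ≤ 1) ∧
      (∀ i, ∑ a ∈ Finset.range (n * 2 ^ k),
        (h i ((a + 1 : ℕ) / 2 ^ k) - h i ((a : ℕ) / 2 ^ k)) * x a = 0) ∧
      ((Finset.range (n * 2 ^ k)).filter (|x ·| ≠ 1)).card ≤ n ∧
      ((Finset.range (n * 2 ^ k)).filter fun a ↦ ¬ (|x a| = 1 ∧ x (a + 1) = x a)).card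
        ≤ n + n * k := by
  classical
  induction k with
  | zero => exact ⟨0, by simp, by simp, (Finset.card_filter_le _ _).trans (by simp),
      (Finset.card_filter_le _ _).trans (by simp)⟩
  | succ k ih =>
    obtain ⟨x, h1, h2, h3, h4⟩ := ih
    obtain ⟨x', g1, g2, g3, g4⟩ := exists_coloring_few_fractional
      (Finset.range (n * 2 ^ (k + 1))) Finset.univ
      (fun i a ↦ h i ((a + 1 : ℕ) / 2 ^ (k + 1)) - h i ((a : ℕ) / 2 ^ (k + 1)))
      (fun a ↦ x (a / 2)) (fun a ↦ h1 _)
    refine ⟨x', g1, fun i ↦ ?_, by simpa using g4, ?_⟩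
    · rw [g3 i (Finset.mem_univ _), ← h2 i, pow_succ, ← mul_assoc]
      have hsum : ∀ (u : ℕ → ℝ) (M : ℕ), ∑ a ∈ Finset.range (M * 2), u a =
          ∑ a ∈ Finset.range M, (u (2 * a) + u (2 * a + 1)) := fun u M ↦ by
        induction M with
        | zero => simp
        | succ M ih => rw [add_mul, one_mul, Finset.sum_range_succ, Finset.sum_range_succ, ih,
            Finset.sum_range_succ, mul_comm M]; ring
      rw [hsum]
      refine Finset.sum_congr rfl fun a _ ↦ ?_
      have e1 : (2 * a + 1) / 2 = a := by omega
      have e2 : (2 * a) / 2 = a := by omega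
      have e3 : (((2 * a : ℕ) : ℝ)) / (2 ^ k * 2) = a / 2 ^ k := by push_cast; field_simp
      have e4 : (((2 * a + 1 + 1 : ℕ) : ℝ)) / (2 ^ k * 2) = (a + 1 : ℕ) / 2 ^ k := by
        push_cast; field_simp; ring
      rw [e1, e2, pow_succ, e3, e4]
      ring
    · have hsub : ((Finset.range (n * 2 ^ (k + 1))).filter
          fun a ↦ ¬ (|x' a| = 1 ∧ x' (a + 1) = x' a)) ⊆
          ((Finset.range (n * 2 ^ k)).filter (|x ·| ≠ 1)).image (2 * ·) ∪
          ((Finset.range (n * 2 ^ k)).filter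
            fun a ↦ ¬ (|x a| = 1 ∧ x (a + 1) = x a)).image (2 * · + 1) := by
        intro b hb
        simp only [Finset.mem_filter, Finset.mem_range, Finset.mem_union, Finset.mem_image,
          pow_succ, ← mul_assoc] at hb ⊢
        obtain ⟨hb, hbad⟩ := hb
        rcases Nat.even_or_odd' b with ⟨a, rfl | rfl⟩
        · refine Or.inl ⟨a, ⟨by omega, fun hxa ↦ hbad ?_⟩, rfl⟩
          have e1 := g2 (2 * a) fun _ ↦ by simpa using hxa
          have e2 := g2 (2 * a + 1) fun _ ↦ by
            rwa [show (2 * a + 1) / 2 = a by omega]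
          rw [show (2 * a + 1) / 2 = a by omega] at e2
          rw [show (2 * a) / 2 = a by omega] at e1
          rw [e1, e2]
          exact ⟨hxa, rfl⟩
        · refine Or.inr ⟨a, ⟨by omega, fun hxa ↦ hbad ?_⟩, rfl⟩
          have e1 := g2 (2 * a + 1) fun _ ↦ by
            rw [show (2 * a + 1) / 2 = a by omega]; exact hxa.1
          have e2 := g2 (2 * a + 1 + 1) fun _ ↦ by
            rw [show (2 * a + 1 + 1) / 2 = a + 1 by omega, hxa.2]; exact hxa.1
          rw [show (2 * a + 1) / 2 = a by omega] at e1
          rw [show (2 * a + 1 + 1) / 2 = a + 1 by omega] at e2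
          rw [e1, e2]
          exact hxa
      refine (Finset.card_le_card hsub).trans ((Finset.card_union_le _ _).trans
        ((add_le_add (Finset.card_image_le.trans h3) (Finset.card_image_le.trans h4)).trans ?_))
      rw [mul_add]; omega

theorem exists_le_succ_iff {p : ℕ → Prop} {m : ℕ} :
    (∃ j ≤ m + 1, p j) ↔ (∃ j ≤ m, p j) ∨ p (m + 1) := by
  simp [Nat.le_succ_iff, or_and_right, exists_or]

/-- Consecutive intervals of the same colour can be merged, leaving one more interval than there are
colour changes. -/
theorem exists_merged_partition (t : ℕ → ℝ) (ht : Monotone t) (f : ℕ → Bool) (m : ℕ) :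
    ∃ K ≤ ((Finset.range m).filter fun a ↦ f (a + 1) ≠ f a).card,
      ∃ (t' : ℕ → ℝ) (f' : ℕ → Bool), (∀ j ≤ K, t' j ≤ t' (j + 1)) ∧ t' 0 = t 0 ∧
        t' (K + 1) = t (m + 1) ∧ f' K = f m ∧
        ∀ b y, (∃ j ≤ K, f' j = b ∧ y ∈ Icc (t' j) (t' (j + 1))) ↔
          ∃ j ≤ m, f j = b ∧ y ∈ Icc (t j) (t (j + 1)) := by
  induction m with
  | zero => exact ⟨0, by simp, t, f, fun j _ ↦ ht j.le_succ, rfl, rfl, rfl, fun _ _ ↦ Iff.rfl⟩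
  | succ m ih =>
    obtain ⟨K, hK, t', f', h1, h2, h3, h4, h5⟩ := ih
    have hm := ht (Nat.le_succ (m + 1))
    by_cases hf : f (m + 1) = f m
    · refine ⟨K, hK.trans (Finset.card_le_card (Finset.filter_subset_filter _ (by simp))),
        Function.update t' (K + 1) (t (m + 1 + 1)), f', fun j hj ↦ ?_, by simpa using h2, by simp,
        by rw [h4, hf], fun b y ↦ ?_⟩
      · have := h1 j hj
        rcases hj.lt_or_eq with hj | rfl
        · rwa [Function.update_of_ne (by omega), Function.update_of_ne (by omega)]
        · rw [Function.update_of_ne (by omega), Function.update_self]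
          linarith
      · rw [exists_le_succ_iff, ← h5]
        constructor
        · rintro ⟨j, hj, hb, hy⟩
          rcases hj.lt_or_eq with hj | rfl
          · rw [Function.update_of_ne (by omega), Function.update_of_ne (by omega)] at hy
            exact Or.inl ⟨j, hj.le, hb, hy⟩
          · rw [Function.update_of_ne (by omega), Function.update_self] at hy
            rcases le_total y (t (m + 1)) with hyt | hyt
            · exact Or.inl ⟨j, le_rfl, hb, hy.1, h3 ▸ hyt⟩
            · exact Or.inr ⟨by rw [hf, ← h4, hb], hyt, hy.2⟩
        · rintro (⟨j, hj, hb, hy⟩ | ⟨hb, hy⟩)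
          · refine ⟨j, hj, hb, ?_⟩
            rcases hj.lt_or_eq with hj | rfl
            · rwa [Function.update_of_ne (by omega), Function.update_of_ne (by omega)]
            · rw [Function.update_of_ne (by omega), Function.update_self]
              exact ⟨hy.1, hy.2.trans (h3 ▸ hm)⟩
          · refine ⟨K, le_rfl, by rw [h4, ← hf, hb], ?_⟩
            rw [Function.update_of_ne (by omega), Function.update_self]
            exact ⟨(h1 K le_rfl).trans (h3 ▸ hy.1), hy.2⟩
    · have hcard : ((Finset.range (m + 1)).filter fun a ↦ f (a + 1) ≠ f a).card =
          ((Finset.range m).filter fun a ↦ f (a + 1) ≠ f a).card + 1 := by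
        rw [Finset.range_add_one, Finset.filter_insert, if_pos hf,
          Finset.card_insert_of_notMem (by simp)]
      refine ⟨K + 1, by omega, Function.update t' (K + 1 + 1) (t (m + 1 + 1)),
        Function.update f' (K + 1) (f (m + 1)), fun j hj ↦ ?_, by simpa using h2, by simp,
        by simp, fun b y ↦ ?_⟩
      · rcases hj.lt_or_eq with hj | rfl
        · rw [Function.update_of_ne (by omega), Function.update_of_ne (by omega)]
          exact h1 j (by omega)
        · rw [Function.update_of_ne (by omega), Function.update_self]
          linarith
      · rw [exists_le_succ_iff, exists_le_succ_iff, ← h5, Function.update_self,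
          Function.update_self, Function.update_of_ne (by omega), h3]
        refine or_congr_left (exists_congr fun j ↦ and_congr_right fun hj ↦ ?_)
        rw [Function.update_of_ne (by omega), Function.update_of_ne (by omega),
          Function.update_of_ne (by omega)]

/-- A continuous monotone function from `[0, 1]` onto `[0, c]` has a monotone right inverse. -/
theorem exists_quantile (G : ℝ → ℝ) (hG : Continuous G) (hmono : Monotone G) {c : ℝ} (hc : 0 < c)
    (h0 : G 0 = 0) (h1 : G 1 = c) :
    ∃ q : ℝ → ℝ, Monotone q ∧ q 0 = 0 ∧ q c = 1 ∧ ∀ y ∈ Icc 0 c, G (q y) = y := by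
  have hex : ∀ y ∈ Icc 0 c, ∃ z ∈ Icc (0 : ℝ) 1, G z = y := fun y hy ↦
    intermediate_value_Icc zero_le_one hG.continuousOn (by rwa [h0, h1])
  choose! p hp hGp using hex
  refine ⟨fun y ↦ if y ≤ 0 then 0 else if c ≤ y then 1 else p y, fun y z hyz ↦ ?_, by simp,
    by simp [hc.not_ge], fun y hy ↦ ?_⟩
  · dsimp only
    split_ifs with a1 a2 a3 a4 a5 a6 a7 <;> try linarith
    · exact (hp z ⟨by linarith, by linarith⟩).1
    · exact (hp y ⟨by linarith, by linarith⟩).2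
    · by_contra! hlt
      have := hmono hlt.le
      rw [hGp y ⟨by linarith, by linarith⟩, hGp z ⟨by linarith, by linarith⟩] at this
      rw [le_antisymm hyz this] at hlt
      exact hlt.false
  · dsimp only
    split_ifs with a1 a2
    · rw [h0]; exact le_antisymm hy.1 a1
    · rw [h1]; exact le_antisymm a2 hy.2
    · exact hGp y hy

theorem continuous_cdf_of_nullSingletonClass (μ : Measure ℝ) [IsProbabilityMeasure μ]
    [NullSingletonClass μ] : Continuous (ProbabilityTheory.cdf μ) := by
  set F := ProbabilityTheory.cdf μ with hF
  refine continuous_iff_continuousAt.2 fun x ↦ ?_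
  rw [F.mono.continuousAt_iff_leftLim_eq_rightLim, F.rightLim_eq]
  have h := F.measure_singleton x
  rw [hF, ProbabilityTheory.measure_cdf, measure_singleton, eq_comm, ENNReal.ofReal_eq_zero] at h
  exact le_antisymm (F.mono.leftLim_le le_rfl) (by linarith)

theorem measure_biUnion_Icc_succ (μ : Measure ℝ) [IsProbabilityMeasure μ] [NullSingletonClass μ]
    (t : ℕ → ℝ) (ht : Monotone t) (s : Finset ℕ) :
    μ (⋃ j ∈ s, Icc (t j) (t (j + 1))) = ENNReal.ofReal
      (∑ j ∈ s, (ProbabilityTheory.cdf μ (t (j + 1)) - ProbabilityTheory.cdf μ (t j))) := by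
  have hIoc : ∀ j, μ (Ioc (t j) (t (j + 1))) = ENNReal.ofReal
      (ProbabilityTheory.cdf μ (t (j + 1)) - ProbabilityTheory.cdf μ (t j)) := fun j ↦ by
    rw [← StieltjesFunction.measure_Ioc, ProbabilityTheory.measure_cdf]
  rw [ENNReal.ofReal_sum_of_nonneg fun j _ ↦
    sub_nonneg.2 (ProbabilityTheory.monotone_cdf μ (ht j.le_succ))]
  simp only [← hIoc]
  apply le_antisymm
  · refine (measure_biUnion_finset_le _ _).trans_eq ?_
    exact Finset.sum_congr rfl fun j _ ↦ Ioc_ae_eq_Icc.symm.measure_eq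
  · rw [← measure_biUnion_finset]
    · exact measure_mono (iUnion₂_mono fun j _ ↦ Ioc_subset_Icc_self)
    · exact ht.pairwise_disjoint_on_Ioc_succ.set_pairwise _
    · exact fun _ _ ↦ measurableSet_Ioc

/-- A sign colouring of the dyadic intervals of length `2⁻ᵏ` in `[0, n]` with discrepancy at most
`2 * 2⁻ᵏ` and at most `n + n * k` colour changes. -/
theorem exists_sign_coloring_few_changes (n : ℕ) (k : ℕ) (h : Fin n → ℝ → ℝ)
    (hmono : ∀ i, MonotoneOn (h i) (Icc 0 n)) (hsum : ∀ y ∈ Icc (0 : ℝ) n, ∑ i, h i y = y) :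
    ∃ x : ℕ → ℝ, (∀ a ∈ Finset.range (n * 2 ^ k), |x a| = 1) ∧
      (∀ i, |∑ a ∈ Finset.range (n * 2 ^ k),
        (h i ((a + 1 : ℕ) / 2 ^ k) - h i ((a : ℕ) / 2 ^ k)) * x a| ≤ 2 * (1 / 2 ^ k)) ∧
      ((Finset.range (n * 2 ^ k)).filter fun a ↦ x (a + 1) ≠ x a).card ≤ n + n * k := by
  obtain ⟨x, h1, h2, -, h4⟩ := exists_dyadic_coloring n k h
  have hmem : ∀ a ≤ n * 2 ^ k, (a : ℝ) / 2 ^ k ∈ Icc (0 : ℝ) n := fun a ha ↦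
    ⟨by positivity, by rw [div_le_iff₀ (by positivity)]; exact_mod_cast ha⟩
  obtain ⟨x', g1, -, g3, g4⟩ := exists_sign_rounding (Finset.range (n * 2 ^ k)) Finset.univ
    (fun i a ↦ h i ((a + 1 : ℕ) / 2 ^ k) - h i ((a : ℕ) / 2 ^ k))
    (fun i a ha ↦ by
      rw [Finset.mem_range] at ha
      refine sub_nonneg.2 (hmono i (hmem a ha.le) (hmem _ ha) ?_)
      gcongr
      omega) (1 / 2 ^ k) (by positivity)
    (fun a ha ↦ by
      rw [Finset.mem_range] at ha
      rw [Finset.sum_sub_distrib, hsum _ (hmem a ha.le), hsum _ (hmem _ ha)]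
      push_cast
      exact le_of_eq (by ring)) x h1
  refine ⟨x', g1, fun i ↦ by simpa only [h2 i, sub_zero] using g4 i (Finset.mem_univ i),
    (Finset.card_le_card fun a ha ↦ ?_).trans h4⟩
  rw [Finset.mem_filter] at ha ⊢
  refine ⟨ha.1, fun hxa ↦ ha.2 ?_⟩
  rw [g3 a fun _ ↦ hxa.1, g3 (a + 1) fun _ ↦ hxa.2 ▸ hxa.1, hxa.2]

/-- If the signed sum of weights of total `1` is at most `ε`, both colour classes have weight within
`ε / 2` of `1 / 2`. -/
theorem sum_filter_sign_mem_Icc {ι : Type*} (s : Finset ι) (w x : ι → ℝ)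
    (hx : ∀ a ∈ s, |x a| = 1) (hw : ∑ a ∈ s, w a = 1) {ε : ℝ} (hε : |∑ a ∈ s, w a * x a| ≤ ε)
    (b : Bool) :
    ∑ a ∈ s with decide (x a = 1) = b, w a ∈ Icc (1 / 2 - ε / 2) (1 / 2 + ε / 2) := by
  have key : ∑ a ∈ s with decide (x a = 1) = b, w a =
      (∑ a ∈ s, w a + (if b then 1 else -1) * ∑ a ∈ s, w a * x a) / 2 := by
    rw [Finset.sum_filter, Finset.mul_sum, ← Finset.sum_add_distrib, Finset.sum_div]
    refine Finset.sum_congr rfl fun a ha ↦ ?_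
    rcases eq_or_eq_neg_of_abs_eq (hx a ha) with h | h <;> cases b <;> norm_num [h]
  have := abs_le.1 hε
  rw [key, hw]
  cases b <;> constructor <;> simp <;> linarith

/-- At most `n(2 + ⌈log₂(1/ε)⌉)` cuts suffice for ε-Consensus Halving. -/
theorem offline_consensus_halving
    (n : ℕ) (hn : 1 ≤ n) (ε : ℝ) (hε : ε ∈ Set.Ioo (0 : ℝ) 1)
    (μ : Fin n → Measure ℝ)
    (hprob : ∀ i, IsProbabilityMeasure (μ i))
    (hsupp : ∀ i, μ i (Set.Icc (0 : ℝ) 1) = 1)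
    (hna : ∀ i (x : ℝ), μ i {x} = 0) :
    ∃ N : ℕ, (N : ℤ) ≤ (n : ℤ) * (2 + ⌈Real.logb 2 (1 / ε)⌉) + 1 ∧
      ∃ t : Fin (N + 1) → ℝ, Monotone t ∧ t 0 = 0 ∧ t (Fin.last N) = 1 ∧
        ∃ f : Fin N → Bool,
          ∀ (i : Fin n) (a : Bool),
            μ i (⋃ j ∈ {j : Fin N | f j = a}, Set.Icc (t j.castSucc) (t j.succ))
              ∈ Set.Icc (ENNReal.ofReal (1 / 2 - ε / 2)) (ENNReal.ofReal (1 / 2 + ε / 2)) := by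
  have hatoms : ∀ i, NullSingletonClass (μ i) := fun i ↦ ⟨hna i⟩
  have hn0 : (0 : ℝ) < n := by exact_mod_cast hn
  let H : Fin n → ℝ → ℝ := fun i ↦ ProbabilityTheory.cdf (μ i)
  have hH0 : ∀ i, H i 0 = 0 := fun i ↦ by
    have hIio : μ i (Iio 0) = 0 := by
      refine measure_mono_null (fun y hy ↦ ?_)
        ((prob_compl_eq_zero_iff measurableSet_Icc).2 (hsupp i))
      exact fun h ↦ absurd h.1 (not_le.2 hy)
    simp only [H, ProbabilityTheory.cdf_eq_real, measureReal_def]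
    rw [← Iio_ae_eq_Iic.measure_eq, hIio, ENNReal.toReal_zero]
  have hH1 : ∀ i, H i 1 = 1 := fun i ↦ by
    have hIic : μ i (Iic 1) = 1 :=
      le_antisymm prob_le_one ((hsupp i).symm.le.trans (measure_mono fun y hy ↦ hy.2))
    simp only [H, ProbabilityTheory.cdf_eq_real, measureReal_def]
    rw [hIic, ENNReal.toReal_one]
  have hHmono : ∀ i, Monotone (H i) := fun i ↦ ProbabilityTheory.monotone_cdf (μ i)
  obtain ⟨q, hq, hq0, hq1, hGq⟩ := exists_quantile (fun z ↦ ∑ i, H i z)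
    (continuous_finsetSum _ fun i _ ↦ continuous_cdf_of_nullSingletonClass (μ i))
    (fun y z hyz ↦ Finset.sum_le_sum fun i _ ↦ hHmono i hyz) hn0 (by simp [hH0]) (by simp [hH1])
  have hlog : 0 < Real.logb 2 (1 / ε) :=
    Real.logb_pos one_lt_two (by rw [lt_div_iff₀ hε.1]; linarith [hε.2])
  obtain ⟨l, hl⟩ := Int.eq_ofNat_of_zero_le (Int.ceil_nonneg hlog.le)
  have hlε : 1 / ε ≤ 2 ^ l := by
    have h1 := Int.le_ceil (Real.logb 2 (1 / ε))
    rw [hl, Real.logb_le_iff_le_rpow one_lt_two (one_div_pos.2 hε.1)] at h1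
    simpa using h1
  obtain ⟨x, hx1, hx2, hx3⟩ := exists_sign_coloring_few_changes n (l + 1) (fun i y ↦ H i (q y))
    (fun i ↦ ((hHmono i).comp hq).monotoneOn _) hGq
  have hk : 2 * (1 / (2 : ℝ) ^ (l + 1)) ≤ ε := by
    rw [div_le_iff₀ hε.1] at hlε
    rw [pow_succ, mul_one_div, div_le_iff₀ (by positivity)]
    linarith
  obtain ⟨m, hm⟩ : ∃ m, n * 2 ^ (l + 1) = m + 1 :=
    Nat.exists_eq_add_one.2 (by positivity)
  rw [hm] at hx1 hx2 hx3
  let t : ℕ → ℝ := fun a ↦ q (a / 2 ^ (l + 1))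
  have ht : Monotone t := fun a b hab ↦ hq (by gcongr)
  have ht0 : t 0 = 0 := by simp [t, hq0]
  have htm : t (m + 1) = 1 := by
    simp only [t]
    rw [← hm, ← hq1]
    congr 1
    push_cast
    field_simp
  obtain ⟨K, hK, t', f', h1, h2, h3, -, h5⟩ :=
    exists_merged_partition t ht (fun a ↦ decide (x a = 1)) m
  have hKn : K ≤ n + n * (l + 1) := by
    refine hK.trans ((Finset.card_le_card fun a ha ↦ ?_).trans hx3)
    rw [Finset.mem_filter, Finset.mem_range] at ha ⊢
    exact ⟨by omega, fun h ↦ ha.2 (by simp only [h])⟩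
  refine ⟨K + 1, ?_, fun j ↦ t' j, Fin.monotone_iff_le_succ.2 fun j ↦ ?_, by simp [h2, ht0],
    by simp [h3, htm], fun j ↦ f' j, fun i b ↦ ?_⟩
  · rw [hl]
    zify at hKn
    push_cast
    linarith
  · simpa using h1 j (by omega)
  · have hU : (⋃ j ∈ {j : Fin (K + 1) | f' j = b}, Icc (t' j.castSucc) (t' j.succ)) =
        ⋃ j ∈ (Finset.range (m + 1)).filter (fun a ↦ decide (x a = 1) = b),
          Icc (t j) (t (j + 1)) := by
      ext y
      have := h5 b y
      simp only [mem_iUnion, exists_prop, mem_ofPred_eq, Finset.mem_filter, Finset.mem_range,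
        Order.lt_add_one_iff, and_assoc, Fin.exists_iff, Fin.val_castSucc, Fin.val_succ] at this ⊢
      exact this
    rw [hU, measure_biUnion_Icc_succ (μ i) t ht]
    have hs := sum_filter_sign_mem_Icc (Finset.range (m + 1))
      (fun a ↦ H i (t (a + 1)) - H i (t a)) x hx1
      (by rw [Finset.sum_range_sub fun a ↦ H i (t a), ht0, htm, hH0, hH1, sub_zero])
      ((hx2 i).trans hk) b
    exact ⟨ENNReal.ofReal_le_ofReal hs.1, ENNReal.ofReal_le_ofReal hs.2⟩
end

section
/- Let n ≥ 1 and consider a necklace: a finite sequence of beads each colored by one of n colors, with m_i ≥ 1 beads of color i, and let m = max_i m_i. Then there exists a partition of the beads into at most n(3 + ⌈log₂ m⌉) + 1 intervals of consecutive beads together with an assignment of these intervals to two agents, such that for every color i each agent receives either ⌊m_i/2⌋ or ⌈m_i/2⌉ beads of color i. (That is, at most n(3 + ⌈log₂ m⌉) = O(n log m) cuts suffice for Necklace Halving.) -/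
/-- A fractional point of the cube `[-1, 1]^ι` can be moved, without changing the weighted sum
`∑ z j • v j` or any coordinate equal to `±1`, until the vectors `v j` at its fractional
coordinates are linearly independent. -/
theorem exists_linearIndepOn_fractional {ι E : Type*} [AddCommGroup E] [Module ℚ E]
    (S : Finset ι) (v : ι → E) (y : ι → ℚ) (hy : ∀ j, |y j| ≤ 1) :
    ∃ z : ι → ℚ, (∀ j, |z j| ≤ 1) ∧ (∀ j, |y j| = 1 → z j = y j) ∧
      ∑ j ∈ S, z j • v j = ∑ j ∈ S, y j • v j ∧
      LinearIndepOn ℚ v (S.filter (fun j => |z j| < 1) : Finset ι) := by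
  induction hN : (S.filter (fun j => |y j| < 1)).card using Nat.strong_induction_on
    generalizing y with
  | _ N ih =>
  subst hN
  by_cases hli : LinearIndepOn ℚ v (S.filter (fun j => |y j| < 1) : Finset ι)
  · exact ⟨y, hy, fun _ _ => rfl, rfl, hli⟩
  classical
  set F := S.filter (fun j => |y j| < 1) with hF
  rw [linearIndepOn_finset_iff] at hli
  push Not at hli
  obtain ⟨w, hw0, j₀, hj₀, hwj₀⟩ := hli
  set G := F.filter (fun j => w j ≠ 0) with hG
  obtain ⟨k, hk, hkmin⟩ := G.exists_min_image
    (fun j => if 0 < w j then (1 - y j) / w j else (-1 - y j) / w j)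
    ⟨j₀, by simp [hG, hj₀, hwj₀]⟩
  set t : ℚ := if 0 < w k then (1 - y k) / w k else (-1 - y k) / w k with ht
  have hFy : ∀ j ∈ F, -1 < y j ∧ y j < 1 := fun j hj => by
    simpa [hF, abs_lt] using (Finset.mem_filter.1 hj).2
  have hkF : k ∈ F := (Finset.mem_filter.1 hk).1
  have hwk : w k ≠ 0 := (Finset.mem_filter.1 hk).2
  have ht0 : 0 ≤ t := by
    have := hFy k hkF
    rw [ht]
    split_ifs with h
    · exact div_nonneg (by linarith) h.le
    · exact div_nonneg_of_nonpos (by linarith) (not_lt.1 h)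
  have htk : |y k + t * w k| = 1 := by
    rw [ht]
    split_ifs with h <;> rw [div_mul_cancel₀ _ hwk] <;> norm_num
  let z : ι → ℚ := fun j => if j ∈ F then y j + t * w j else y j
  have hz : ∀ j, |z j| ≤ 1 := by
    intro j
    by_cases hj : j ∈ F
    · have hjy := hFy j hj
      simp only [z, if_pos hj]
      rw [abs_le]
      rcases lt_trichotomy (w j) 0 with h | h | h
      · have := hkmin j (Finset.mem_filter.2 ⟨hj, h.ne⟩)
        rw [if_neg (not_lt.2 h.le), le_div_iff_of_neg h] at this
        exact ⟨by linarith, by nlinarith⟩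
      · rw [h]
        exact ⟨by linarith, by linarith⟩
      · have := hkmin j (Finset.mem_filter.2 ⟨hj, h.ne'⟩)
        rw [if_pos h, le_div_iff₀ h] at this
        exact ⟨by nlinarith, by linarith⟩
    · simpa [z, hj] using hy j
  have hzy : ∀ j, |y j| = 1 → z j = y j := by
    intro j hj
    have : j ∉ F := by simp [hF, hj]
    simp [z, this]
  have hsum : ∑ j ∈ S, z j • v j = ∑ j ∈ S, y j • v j := by
    have h1 : ∀ j ∈ S, z j • v j = y j • v j + (if j ∈ F then t • w j • v j else 0) := by
      intro j _
      by_cases hj : j ∈ F <;> simp [z, hj, add_smul, mul_smul]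
    have h2 : S.filter (fun j => j ∈ F) = F := by
      ext j
      simp +contextual [hF]
    rw [Finset.sum_congr rfl h1, Finset.sum_add_distrib, ← Finset.sum_filter, h2,
      ← Finset.smul_sum, hw0, smul_zero, add_zero]
  have hlt : (S.filter (fun j => |z j| < 1)).card < F.card := by
    refine Finset.card_lt_card (Finset.ssubset_iff_of_subset ?_ |>.2 ⟨k, hkF, ?_⟩)
    · intro j hj
      rw [Finset.mem_filter] at hj
      refine Finset.mem_filter.2 ⟨hj.1, lt_of_le_of_ne (hy j) fun h => ?_⟩
      rw [hzy j h, h] at hj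
      exact lt_irrefl _ hj.2
    · simp [z, hkF, htk]
  obtain ⟨x, hx1, hx2, hx3, hx4⟩ := ih _ hlt z hz rfl
  refine ⟨x, hx1, fun j hj => ?_, hx3.trans hsum, hx4⟩
  rw [hx2 j (by rw [hzy j hj, hj]), hzy j hj]

/-- The vector of color counts of the `j`-th block of `q` consecutive beads. -/
def blockCount {n : ℕ} (L : ℕ) (c : ℕ → Fin n) (q j : ℕ) (i : Fin n) : ℚ :=
  ((Finset.range L).filter (fun b => c b = i ∧ b / q = j)).card

/-- A fractional allocation of `N` blocks of `q` beads with values in `[-1, 1]` that is balanced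
in every color and has at most `B` cuts, where the right end of every fractional block counts
as a cut. -/
structure IsBalanced {n : ℕ} (L : ℕ) (c : ℕ → Fin n) (q N B : ℕ) (y : ℕ → ℚ) : Prop where
  le_mul : L ≤ N * q
  abs_le_one : ∀ j, |y j| ≤ 1
  sum_eq_zero : ∀ i, ∑ b ∈ Finset.range L with c b = i, y (b / q) = 0
  card_cuts_le : ((Finset.range N).filter (fun j => y j ≠ y (j + 1) ∨ |y j| < 1)).card ≤ B

theorem sum_smul_blockCount {n L : ℕ} {c : ℕ → Fin n} {q N : ℕ} (hL : L ≤ N * q) (y : ℕ → ℚ)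
    (i : Fin n) :
    (∑ j ∈ Finset.range N, y j • blockCount L c q j) i =
      ∑ b ∈ Finset.range L with c b = i, y (b / q) := by
  have hmaps : ∀ b ∈ (Finset.range L).filter (fun b => c b = i), b / q ∈ Finset.range N := by
    intro b hb
    rw [Finset.mem_filter, Finset.mem_range] at hb
    exact Finset.mem_range.2 (Nat.div_lt_of_lt_mul (by rw [mul_comm]; omega))
  rw [← Finset.sum_fiberwise_of_maps_to hmaps, Finset.sum_apply]
  refine Finset.sum_congr rfl fun j _ => ?_
  rw [Finset.filter_filter, Finset.sum_congr rfl (g := fun _ => y j)]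
  · simp [blockCount, mul_comm]
  · intro b hb
    rw [(Finset.mem_filter.1 hb).2.2]

theorem IsBalanced.exists_linearIndepOn {n L : ℕ} {c : ℕ → Fin n} {q N B : ℕ} {y : ℕ → ℚ}
    (h : IsBalanced L c q N B y) :
    ∃ z, IsBalanced L c q N B z ∧
      LinearIndepOn ℚ (blockCount L c q)
        ((Finset.range N).filter (fun j => |z j| < 1) : Finset ℕ) := by
  obtain ⟨z, hz, hzy, hsum, hli⟩ :=
    exists_linearIndepOn_fractional (Finset.range N) (blockCount L c q) y h.abs_le_one
  refine ⟨z, ⟨h.le_mul, hz, fun i => ?_, (Finset.card_le_card ?_).trans h.card_cuts_le⟩, hli⟩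
  · rw [← sum_smul_blockCount h.le_mul, hsum, sum_smul_blockCount h.le_mul, h.sum_eq_zero]
  · refine Finset.monotone_filter_right _ fun j _ hj => ?_
    by_contra hcon
    push Not at hcon
    have h1 : |y j| = 1 := le_antisymm (h.abs_le_one j) hcon.2
    have h2 : |y (j + 1)| = 1 := by rw [← hcon.1, h1]
    rw [hzy j h1, hzy (j + 1) h2, h1] at hj
    exact hj.elim (fun h => h hcon.1) (lt_irrefl _)

theorem IsBalanced.halve {n L : ℕ} {c : ℕ → Fin n} {q N B : ℕ} {y : ℕ → ℚ}
    (h : IsBalanced L c (2 * q) N B y)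
    (hli : LinearIndepOn ℚ (blockCount L c (2 * q))
      ((Finset.range N).filter (fun j => |y j| < 1) : Finset ℕ)) :
    IsBalanced L c q (N * 2) (B + n) (fun j => y (j / 2)) where
  le_mul := by simpa [mul_assoc] using h.le_mul
  abs_le_one j := h.abs_le_one _
  sum_eq_zero i := by
    simpa [Nat.div_div_eq_div_mul, mul_comm] using h.sum_eq_zero i
  card_cuts_le := by
    have hfrac : ((Finset.range N).filter (fun j => |y j| < 1)).card ≤ n := by
      have := hli.fintype_card_le_finrank
      simpa using this
    refine le_trans (Finset.card_le_card (t :=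
      ((Finset.range N).filter (fun j => y j ≠ y (j + 1) ∨ |y j| < 1)).image
          (fun j => 2 * j + 1) ∪
        ((Finset.range N).filter (fun j => |y j| < 1)).image (fun j => 2 * j)) ?_) ?_
    · intro j hj
      rw [Finset.mem_filter, Finset.mem_range] at hj
      obtain ⟨hjN, hj⟩ := hj
      rw [Finset.mem_union, Finset.mem_image, Finset.mem_image]
      obtain ⟨k, rfl | rfl⟩ := j.even_or_odd'
      · right
        rw [show 2 * k / 2 = k by omega, show (2 * k + 1) / 2 = k by omega] at hj
        exact ⟨k, Finset.mem_filter.2 ⟨Finset.mem_range.2 (by omega), by simpa using hj⟩, rfl⟩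
      · left
        rw [show (2 * k + 1) / 2 = k by omega, show (2 * k + 1 + 1) / 2 = k + 1 by omega] at hj
        exact ⟨k, Finset.mem_filter.2 ⟨Finset.mem_range.2 (by omega), hj⟩, rfl⟩
    · exact (Finset.card_union_le _ _).trans (add_le_add
        (Finset.card_image_le.trans h.card_cuts_le) (Finset.card_image_le.trans hfrac))

theorem exists_isBalanced_linearIndepOn {n L K : ℕ} (c : ℕ → Fin n) (hL : L ≤ n * 2 ^ K)
    (k t : ℕ) (hkt : k + t = K) :
    ∃ y, IsBalanced L c (2 ^ k) (n * 2 ^ t) (n + n * t) y ∧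
      LinearIndepOn ℚ (blockCount L c (2 ^ k))
        ((Finset.range (n * 2 ^ t)).filter (fun j => |y j| < 1) : Finset ℕ) := by
  induction t generalizing k with
  | zero =>
    obtain rfl : k = K := by omega
    have h : IsBalanced L c (2 ^ k) (n * 2 ^ 0) (n + n * 0) (fun _ => 0) :=
      ⟨by simpa using hL, by simp, by simp, by simp⟩
    exact h.exists_linearIndepOn
  | succ t ih =>
    obtain ⟨y, hy, hli⟩ := ih (k + 1) (by omega)
    rw [pow_succ'] at hy hli
    have := (hy.halve hli).exists_linearIndepOn
    rwa [mul_assoc, ← pow_succ, add_assoc, ← mul_add_one] at this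

/-- Rounding the fractional values to `±1` when at most one of them is not integral changes the
sum by at most one. -/
theorem abs_sum_ite_pos_sub_sum_le_one (S : Finset ℕ) (y : ℕ → ℚ) (hy : ∀ b, |y b| ≤ 1)
    (hS : ∀ a ∈ S, ∀ b ∈ S, |y a| < 1 → |y b| < 1 → a = b) :
    |∑ b ∈ S, (if 0 < y b then (1 : ℚ) else -1) - ∑ b ∈ S, y b| ≤ 1 := by
  rw [← Finset.sum_sub_distrib]
  have hone : ∀ b, |y b| = 1 → (if 0 < y b then (1 : ℚ) else -1) - y b = 0 := by
    intro b hb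
    rcases eq_or_eq_neg_of_abs_eq hb with h | h <;> rw [h] <;> norm_num
  by_cases hex : ∃ a ∈ S, |y a| < 1
  · obtain ⟨a, haS, ha⟩ := hex
    rw [Finset.sum_eq_single_of_mem a haS fun b hb hba => hone b
      (le_antisymm (hy b) (not_lt.1 fun h => hba (hS b hb a haS h ha)))]
    rw [abs_lt] at ha
    rw [abs_le]
    split_ifs <;> constructor <;> linarith
  · push Not at hex
    rw [Finset.sum_eq_zero fun b hb => hone b (le_antisymm (hy b) (hex b hb))]
    simp

/-- At most `n(3 + ⌈log₂ m⌉)` cuts suffice for Necklace Halving: the beads `0, …, L-1`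
colored by `c` can be partitioned into at most `n(3 + ⌈log₂ m⌉) + 1` intervals of
consecutive beads (recorded by the assignment `g`, the number of intervals being one more
than the number of indices where `g` changes) distributed to two agents so that each agent
gets either `⌊m_i/2⌋` or `⌈m_i/2⌉` beads of each color `i`. -/
theorem offline_necklace_halving
    (n L : ℕ) (hn : 1 ≤ n) (c : ℕ → Fin n)
    (mi : Fin n → ℕ)
    (hmi : ∀ i, ((Finset.range L).filter (fun b => c b = i)).card = mi i)
    (hpos : ∀ i, 1 ≤ mi i)
    (m : ℕ) (hm : m = Finset.univ.sup mi) :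
    ∃ g : ℕ → Bool,
      ((Finset.range (L - 1)).filter (fun j => g j ≠ g (j + 1))).card + 1
        ≤ n * (3 + Nat.clog 2 m) + 1 ∧
      ∀ (a : Bool) (i : Fin n),
        ((Finset.range L).filter (fun b => g b = a ∧ c b = i)).card = mi i / 2 ∨
        ((Finset.range L).filter (fun b => g b = a ∧ c b = i)).card = (mi i + 1) / 2 := by
  have hLm : L ≤ n * 2 ^ Nat.clog 2 m := by
    calc L = ∑ i, mi i := by
          rw [← Finset.card_range L, Finset.card_eq_sum_card_fiberwise (f := c)
            (t := Finset.univ) (by simp [Set.MapsTo])]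
          exact Finset.sum_congr rfl fun i _ => hmi i
      _ ≤ ∑ _i : Fin n, m := Finset.sum_le_sum fun i _ => hm ▸ Finset.le_sup (Finset.mem_univ i)
      _ = n * m := by simp
      _ ≤ n * 2 ^ Nat.clog 2 m := Nat.mul_le_mul_left _ (Nat.le_pow_clog one_lt_two m)
  obtain ⟨y, hy, hli⟩ := exists_isBalanced_linearIndepOn c hLm 0 _ (zero_add _)
  refine ⟨fun b => decide (0 < y b), ?_, ?_⟩
  · have hsub : (Finset.range (L - 1)).filter
          (fun j => decide (0 < y j) ≠ decide (0 < y (j + 1))) ⊆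
        (Finset.range (n * 2 ^ Nat.clog 2 m)).filter
          (fun j => y j ≠ y (j + 1) ∨ |y j| < 1) := by
      intro j hj
      rw [Finset.mem_filter, Finset.mem_range] at hj
      refine Finset.mem_filter.2 ⟨Finset.mem_range.2 (by omega), Or.inl fun h => hj.2 ?_⟩
      rw [h]
    have := (Finset.card_le_card hsub).trans hy.card_cuts_le
    rw [mul_add]
    beta_reduce
    omega
  · intro a i
    have hblock : ∀ b < L, blockCount L c (2 ^ 0) b = Pi.single (c b) 1 := by
      intro b hb
      ext k
      by_cases hk : c b = k
      · subst hk
        have : (Finset.range L).filter (fun x => c x = c b ∧ x / 2 ^ 0 = b) = {b} := by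
          ext x
          simp only [Finset.mem_filter, Finset.mem_range, pow_zero, Nat.div_one,
            Finset.mem_singleton]
          grind
        rw [blockCount, this]
        simp
      · have : (Finset.range L).filter (fun x => c x = k ∧ x / 2 ^ 0 = b) = ∅ := by
          ext x
          simp
          grind
        rw [blockCount, this]
        simp [Pi.single_eq_of_ne (Ne.symm hk)]
    have hround := abs_sum_ite_pos_sub_sum_le_one ((Finset.range L).filter (fun b => c b = i)) y
      hy.abs_le_one (by
        intro a ha b hb hya hyb
        rw [Finset.mem_filter, Finset.mem_range] at ha hb
        refine hli.injOn ?_ ?_ ?_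
        · simp only [Finset.coe_filter, Finset.mem_range, Set.mem_ofPred_eq]
          exact ⟨by omega, hya⟩
        · simp only [Finset.coe_filter, Finset.mem_range, Set.mem_ofPred_eq]
          exact ⟨by omega, hyb⟩
        · rw [hblock a ha.1, hblock b hb.1, ha.2, hb.2])
    have hzero := hy.sum_eq_zero i
    simp only [pow_zero, Nat.div_one] at hzero
    rw [hzero, sub_zero, Finset.sum_ite, Finset.sum_const, Finset.sum_const,
      Finset.filter_filter, Finset.filter_filter, nsmul_eq_mul, nsmul_eq_mul, abs_le] at hround
    have htotal := Finset.card_filter_add_card_filter_not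
      (s := (Finset.range L).filter (fun b => c b = i)) (fun b => 0 < y b)
    rw [Finset.filter_filter, Finset.filter_filter, hmi i] at htotal
    have htrue : (Finset.range L).filter (fun b => decide (0 < y b) = true ∧ c b = i) =
        (Finset.range L).filter (fun b => c b = i ∧ 0 < y b) :=
      Finset.filter_congr fun b _ => by simp [and_comm]
    have hfalse : (Finset.range L).filter (fun b => decide (0 < y b) = false ∧ c b = i) =
        (Finset.range L).filter (fun b => c b = i ∧ ¬ 0 < y b) :=
      Finset.filter_congr fun b _ => by simp [and_comm]
    set P := ((Finset.range L).filter (fun b => c b = i ∧ 0 < y b)).card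
    set M := ((Finset.range L).filter (fun b => c b = i ∧ ¬ 0 < y b)).card
    have h1 : M ≤ P + 1 := by
      have : (M : ℚ) ≤ P + 1 := by linarith [hround.1]
      exact_mod_cast this
    have h2 : P ≤ M + 1 := by
      have : (P : ℚ) ≤ M + 1 := by linarith [hround.2]
      exact_mod_cast this
    cases a
    · rw [hfalse]
      omega
    · rw [htrue]
      omega
end

section
/- Let ε > 0 and define M(x,y) = x² + y² + 5εx − 5εy for reals x, y. If p₁, p₂ ≥ 0 satisfy p₁·(10ε + 4x) = p₂·(10ε − 4y), then M(x + p₁, y + p₂) − M(x, y) = p₁² + p₂² and M(x − p₁, y − p₂) − M(x, y) = p₁² + p₂², and in particular both differences are at least (p₁ + p₂)²/2. -/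
/-- Potential increase in the lower bound for online ε-Consensus Halving with three
measures: with `M(x,y) = x² + y² + 5εx − 5εy`, if `p₁(10ε+4x) = p₂(10ε−4y)` with
`p₁, p₂ ≥ 0`, then the potential increases by exactly `p₁² + p₂²` whichever agent
receives the new interval, and `p₁² + p₂² ≥ (p₁+p₂)²/2`. -/
theorem potential_increase
    (ε x y p₁ p₂ : ℝ) (hε : 0 < ε) (hp₁ : 0 ≤ p₁) (hp₂ : 0 ≤ p₂)
    (h : p₁ * (10 * ε + 4 * x) = p₂ * (10 * ε - 4 * y)) :
    (((x + p₁) ^ 2 + (y + p₂) ^ 2 + 5 * ε * (x + p₁) - 5 * ε * (y + p₂))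
        - (x ^ 2 + y ^ 2 + 5 * ε * x - 5 * ε * y) = p₁ ^ 2 + p₂ ^ 2) ∧
    (((x - p₁) ^ 2 + (y - p₂) ^ 2 + 5 * ε * (x - p₁) - 5 * ε * (y - p₂))
        - (x ^ 2 + y ^ 2 + 5 * ε * x - 5 * ε * y) = p₁ ^ 2 + p₂ ^ 2) ∧
    (p₁ + p₂) ^ 2 / 2 ≤ p₁ ^ 2 + p₂ ^ 2 := by
  refine ⟨?_, ?_, ?_⟩
  · linear_combination h / 2
  · linear_combination -h / 2
  · linarith [sq_nonneg (p₁ - p₂), add_sq p₁ p₂, sub_sq p₁ p₂]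
end

section
/- For every integer k ≥ 2 and every real x with 0 ≤ x ≤ 1, one has (k − 2)/k + (1/k)·eˣ + (1/k)·e⁻ˣ ≤ exp(2x²/k); equivalently, 1 + (2/k)(cosh(x) − 1) ≤ exp(2x²/k). -/
theorem cosh_le_one_add_sq {x : ℝ} (hx : |x| ≤ 1) : Real.cosh x ≤ 1 + x ^ 2 := by
  have hpos := (abs_le.mp (Real.abs_exp_sub_one_sub_id_le hx)).2
  have hneg := (abs_le.mp (Real.abs_exp_sub_one_sub_id_le (x := -x) (by rwa [abs_neg]))).2
  rw [Real.cosh_eq]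
  linarith [neg_sq x]

/-- For integers `k ≥ 2` and `0 ≤ x ≤ 1`:
`(k−2)/k + eˣ/k + e⁻ˣ/k ≤ exp(2x²/k)`, equivalently
`1 + (2/k)(cosh x − 1) ≤ exp(2x²/k)`. -/
theorem k_agent_exponential_inequality
    (k : ℕ) (hk : 2 ≤ k) (x : ℝ) (hx0 : 0 ≤ x) (hx1 : x ≤ 1) :
    ((k : ℝ) - 2) / k + (1 / k) * Real.exp x + (1 / k) * Real.exp (-x)
        ≤ Real.exp (2 * x ^ 2 / k) ∧
    1 + (2 / (k : ℝ)) * (Real.cosh x - 1) ≤ Real.exp (2 * x ^ 2 / k) := by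
  have hk0 : (0 : ℝ) < k := by exact_mod_cast (by lia : 0 < k)
  have hbound : Real.cosh x - 1 ≤ x ^ 2 :=
    sub_le_iff_le_add'.mpr (cosh_le_one_add_sq (abs_le.mpr ⟨by linarith, hx1⟩))
  have hcosh : 1 + (2 / (k : ℝ)) * (Real.cosh x - 1) ≤ Real.exp (2 * x ^ 2 / k) := by
    calc 1 + (2 / (k : ℝ)) * (Real.cosh x - 1) ≤ 1 + (2 / (k : ℝ)) * x ^ 2 := by gcongr
      _ = 2 * x ^ 2 / k + 1 := by ring
      _ ≤ Real.exp (2 * x ^ 2 / k) := Real.add_one_le_exp _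
  refine ⟨?_, hcosh⟩
  convert hcosh using 1
  rw [Real.cosh_eq]
  field_simp
  ring
end

section
/- Let n ≥ 2, let ε ∈ (0,1), and set g = ε²/(8 log₂ n). Let a₁, …, a_m be vectors in ℝⁿ such that 0 ≤ a_{j,i} ≤ g for all j ∈ {1,…,m}, i ∈ {1,…,n}, and ∑_{j=1}^{m} a_{j,i} ≤ 1 for every i. Then there exist signs ε₁, …, ε_m ∈ {−1, +1} such that for every i ∈ {1,…,n} and every prefix length t ∈ {1,…,m}, |∑_{j=1}^{t} ε_j a_{j,i}| ≤ ε. -/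
open Finset in
/-- One of the two signs does not increase the weighted potential `∑ w i * cosh (l * D i)`, after
discounting each term by `exp (-(l * b i) ^ 2 / 2)`. -/
theorem exists_sign_potential_le {ι : Type*} [Fintype ι] (l : ℝ) (w D b : ι → ℝ)
    (hw : ∀ i, 0 ≤ w i) :
    ∃ σ : ℝ, (σ = 1 ∨ σ = -1) ∧
      ∑ i, w i * Real.exp (-((l * b i) ^ 2 / 2)) * Real.cosh (l * (D i + σ * b i)) ≤
        ∑ i, w i * Real.cosh (l * D i) := by
  set F : ℝ → ℝ := fun σ =>
    ∑ i, w i * Real.exp (-((l * b i) ^ 2 / 2)) * Real.cosh (l * (D i + σ * b i)) with hF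
  have h_avg : F 1 + F (-1) ≤ 2 * ∑ i, w i * Real.cosh (l * D i) := by
    rw [hF, ← sum_add_distrib, mul_sum]
    refine sum_le_sum fun i _ => ?_
    have h_add : Real.cosh (l * (D i + 1 * b i)) + Real.cosh (l * (D i + -1 * b i)) =
        2 * (Real.cosh (l * D i) * Real.cosh (l * b i)) := by
      rw [show l * (D i + 1 * b i) = l * D i + l * b i by ring,
        show l * (D i + -1 * b i) = l * D i - l * b i by ring, Real.cosh_add, Real.cosh_sub]
      ring
    have h_disc : Real.exp (-((l * b i) ^ 2 / 2)) * Real.cosh (l * b i) ≤ 1 := by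
      calc _ ≤ Real.exp (-((l * b i) ^ 2 / 2)) * Real.exp ((l * b i) ^ 2 / 2) := by
            gcongr
            exact Real.cosh_le_exp_half_sq _
        _ = 1 := by rw [← Real.exp_add]; simp
    have h_nonneg : 0 ≤ w i * Real.cosh (l * D i) := mul_nonneg (hw i) (Real.cosh_pos _).le
    rw [← mul_add, h_add]
    nlinarith [mul_le_mul_of_nonneg_left h_disc h_nonneg]
  rcases le_total (F 1) (F (-1)) with h | h
  · exact ⟨1, Or.inl rfl, by change F 1 ≤ _; linarith⟩
  · exact ⟨-1, Or.inr rfl, by change F (-1) ≤ _; linarith⟩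

open Finset in
/-- Greedy signs for an infinite sequence of vectors keep the discounted potential below its
initial value. -/
theorem exists_signs_potential_le {ι : Type*} [Fintype ι] (l : ℝ) (a : ℕ → ι → ℝ) :
    ∃ s : ℕ → ℝ, (∀ j, s j = 1 ∨ s j = -1) ∧ ∀ t,
      ∑ i, Real.exp (-(l ^ 2 / 2 * ∑ j ∈ range t, a j i ^ 2)) *
        Real.cosh (l * ∑ j ∈ range t, s j * a j i) ≤ Fintype.card ι := by
  have h_step (t : ℕ) (D : ι → ℝ) := exists_sign_potential_le l
    (fun i => Real.exp (-(l ^ 2 / 2 * ∑ j ∈ range t, a j i ^ 2))) D (a t)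
    (fun _ => (Real.exp_pos _).le)
  choose σ hσ hle using h_step
  let D : ℕ → ι → ℝ := fun t => Nat.rec 0 (fun k d i => d i + σ k d * a k i) t
  have h_prefix (t : ℕ) (i : ι) : D t i = ∑ j ∈ range t, σ j (D j) * a j i := by
    induction t with
    | zero => rfl
    | succ k ih => rw [sum_range_succ, ← ih]
  refine ⟨fun t => σ t (D t), fun j => hσ _ _, fun t => ?_⟩
  induction t with
  | zero => simp
  | succ k ih =>
    refine le_trans (le_of_eq ?_) ((hle k (D k)).trans (by simpa only [h_prefix] using ih))
    refine sum_congr rfl fun i _ => ?_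
    rw [sum_range_succ, sum_range_succ, ← h_prefix, ← Real.exp_add]
    congr 2
    ring

open Finset in
theorem sum_filter_val_lt_eq_sum_range {M : Type*} [AddCommMonoid M] {m t : ℕ} (ht : t ≤ m)
    (f : ℕ → M) : ∑ j ∈ univ.filter (fun j : Fin m => (j : ℕ) < t), f j = ∑ j ∈ range t, f j := by
  rw [sum_filter, Fin.sum_univ_eq_sum_range (fun j => if j < t then f j else 0) m, ← sum_filter]
  congr 1
  ext j
  simp only [mem_filter, mem_range]
  omega

/-- Exponential tail estimate with the optimal rate `ε / g`. -/
theorem abs_le_of_cosh_le {N ε g x : ℝ} (hN : 2 ≤ N) (hε : 0 < ε)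
    (hg : g = ε ^ 2 / (8 * Real.logb 2 N))
    (h : Real.cosh (ε / g * x) ≤ N * Real.exp ((ε / g) ^ 2 / 2 * g)) : |x| ≤ ε := by
  have h_log2 : 0 < Real.log 2 := Real.log_pos (by norm_num)
  have h_logN : Real.log 2 ≤ Real.log N := Real.log_le_log (by norm_num) hN
  have h_logb : Real.log N ≤ Real.logb 2 N := by
    rw [Real.logb, le_div_iff₀ h_log2]
    nlinarith [Real.log_two_lt_d9]
  have hg_pos : 0 < g := by rw [hg]; have := h_log2.trans_le (h_logN.trans h_logb); positivity
  have h_ratio : ε ^ 2 / g = 8 * Real.logb 2 N := by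
    rw [hg, div_div_cancel₀ (by positivity)]
  have h_exp : Real.exp (ε / g * |x|) ≤ 2 * N * Real.exp (ε ^ 2 / g / 2) := by
    have h_abs : Real.exp (ε / g * |x|) ≤ 2 * Real.cosh (ε / g * x) := by
      rw [← Real.cosh_abs, abs_mul, abs_of_pos (div_pos hε hg_pos), Real.cosh_eq]
      linarith [Real.exp_pos (-(ε / g * |x|))]
    have h_eq : (ε / g) ^ 2 / 2 * g = ε ^ 2 / g / 2 := by field_simp
    rw [h_eq] at h
    linarith
  have h_log := Real.log_le_log (Real.exp_pos _) h_exp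
  rw [Real.log_exp, Real.log_mul (by positivity) (Real.exp_pos _).ne',
    Real.log_mul (by norm_num) (by positivity), Real.log_exp] at h_log
  have h_mul : ε / g * |x| ≤ ε / g * ε := by
    have : ε / g * ε = ε ^ 2 / g := by ring
    linarith
  exact le_of_mul_le_mul_left h_mul (div_pos hε hg_pos)


/-- Combinatorial core of the online ε-Consensus Halving algorithm: if every interval
has each measure at most `g = ε²/(8 log₂ n)` and each measure totals at most 1, signs
can be chosen so that every prefix discrepancy on every measure is at most `ε`. -/
theorem online_signs_exist
    (n m : ℕ) (hn : 2 ≤ n) (ε : ℝ) (hε : ε ∈ Set.Ioo (0 : ℝ) 1)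
    (a : Fin m → Fin n → ℝ)
    (hbd : ∀ j i, a j i ∈ Set.Icc (0 : ℝ) (ε ^ 2 / (8 * Real.logb 2 n)))
    (hsum : ∀ i, ∑ j, a j i ≤ 1) :
    ∃ s : Fin m → ℝ, (∀ j, s j = 1 ∨ s j = -1) ∧
      ∀ (i : Fin n) (t : ℕ), t ≤ m →
        |∑ j ∈ Finset.univ.filter (fun j : Fin m => (j : ℕ) < t), s j * a j i| ≤ ε := by
  obtain ⟨hε0, -⟩ := hε
  set g := ε ^ 2 / (8 * Real.logb 2 n) with hg
  let b : ℕ → Fin n → ℝ := fun j i => if h : j < m then a ⟨j, h⟩ i else 0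
  have hb_val (j : Fin m) (i : Fin n) : b j i = a j i := by simp [b]
  have hb_sum (t : ℕ) (ht : t ≤ m) (i : Fin n) : ∑ j ∈ Finset.range t, b j i ^ 2 ≤ g := by
    have hg0 : 0 ≤ g := by
      have := Real.logb_nonneg one_lt_two (x := n) (by norm_cast; omega)
      positivity
    rw [← sum_filter_val_lt_eq_sum_range ht (fun j => b j i ^ 2)]
    calc _ ≤ ∑ j : Fin m, b j i ^ 2 :=
          Finset.sum_le_sum_of_subset_of_nonneg (Finset.filter_subset _ _)
            fun _ _ _ => sq_nonneg _
      _ ≤ ∑ j, g * a j i := by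
          refine Finset.sum_le_sum fun j _ => ?_
          rw [hb_val, sq]
          exact mul_le_mul_of_nonneg_right (hbd j i).2 (hbd j i).1
      _ ≤ g := by
          rw [← Finset.mul_sum]
          exact mul_le_of_le_one_right hg0 (hsum i)
  obtain ⟨s, hs, hpot⟩ := exists_signs_potential_le (ε / g) b
  refine ⟨fun j => s j, fun j => hs j, fun i t ht => ?_⟩
  simp_rw [← hb_val]
  rw [sum_filter_val_lt_eq_sum_range ht (fun j => s j * b j i)]
  refine abs_le_of_cosh_le (N := n) (by exact_mod_cast hn) hε0 hg ?_
  have h_term := (Finset.single_le_sum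
    (fun i _ => mul_nonneg (Real.exp_pos _).le (Real.cosh_pos _).le)
    (Finset.mem_univ i)).trans (hpot t)
  rw [Fintype.card_fin, Real.exp_neg, inv_mul_le_iff₀ (Real.exp_pos _),
    mul_comm (Real.exp _)] at h_term
  refine h_term.trans ?_
  gcongr
  exact hb_sum t ht i
end

section
/- Let n ≥ 2 and ε ∈ (0,1), and let μ₁, …, μₙ be non-atomic Borel probability measures on [0,1]. Then there exist points 0 = t₀ ≤ t₁ ≤ … ≤ t_N = 1 with N ≤ ⌈16 n log₂ n / ε²⌉ + 1 and an assignment of each subinterval [t_{j−1}, t_j] to one of two agents such that for every measure i, the shares of the two agents differ by at most ε: |μ_i(U₁) − μ_i(U₂)| ≤ ε, where U_a is the union of the subintervals assigned to agent a. -/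
open MeasureTheory Set

open ProbabilityTheory in
/-- The distribution function of an atomless probability measure on `ℝ` is continuous. -/
theorem continuous_cdf (μ : Measure ℝ) [IsProbabilityMeasure μ] [NullSingletonClass μ] :
    Continuous (cdf μ) := by
  rw [continuous_iff_continuousAt]
  intro x
  have h : (cdf μ).measure {x} = 0 := by rw [measure_cdf]; exact measure_singleton x
  rw [StieltjesFunction.measure_singleton, ENNReal.ofReal_eq_zero, sub_nonpos] at h
  rw [(monotone_cdf μ).continuousAt_iff_leftLim_eq_rightLim, (cdf μ).rightLim_eq]
  exact le_antisymm ((monotone_cdf μ).leftLim_le le_rfl) h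

open ProbabilityTheory in
theorem toReal_measure_Icc_eq_cdf_sub (μ : Measure ℝ) [IsProbabilityMeasure μ] [NullSingletonClass μ]
    {a b : ℝ} (hab : a ≤ b) : (μ (Icc a b)).toReal = cdf μ b - cdf μ a := by
  rw [← measure_congr (Ioc_ae_eq_Icc (μ := μ) (a := a) (b := b))]
  conv_lhs => rw [← measure_cdf μ]
  rw [StieltjesFunction.measure_Ioc, ENNReal.toReal_ofReal]
  exact sub_nonneg.2 (monotone_cdf μ hab)

/-- Signs can be chosen so that a weighted sum of hyperbolic cosines of signed sums is at most
its average over uniformly random signs. -/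
theorem exists_signs_sum_cosh_le {ι κ : Type*} [Fintype ι] [DecidableEq κ] (s : Finset κ)
    (v : ι → κ → ℝ) (w : ι → ℝ) :
    ∃ f : κ → Bool, ∑ i, w i * Real.cosh (∑ j ∈ s, if f j then v i j else -v i j) ≤
      ∑ i, w i * ∏ j ∈ s, Real.cosh (v i j) := by
  induction s using Finset.induction_on generalizing w with
  | empty => exact ⟨fun _ => true, by simp⟩
  | insert a s ha ih =>
    obtain ⟨f, hf⟩ := ih fun i => w i * Real.cosh (v i a)
    have key (b : Bool) (i : ι) :
        (∑ j ∈ insert a s, if Function.update f a b j then v i j else -v i j) =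
          (if b then v i a else -v i a) + ∑ j ∈ s, if f j then v i j else -v i j := by
      rw [Finset.sum_insert ha, Function.update_self]
      congr 1
      refine Finset.sum_congr rfl fun j hj => ?_
      rw [Function.update_of_ne (ne_of_mem_of_not_mem hj ha)]
    by_contra! hcon
    have ht := hcon (Function.update f a true)
    have hf' := hcon (Function.update f a false)
    simp only [key, Finset.prod_insert ha, if_true, Bool.false_eq_true, if_false,
      ← mul_assoc] at ht hf'
    have havg : ∑ i, w i * Real.cosh (v i a + ∑ j ∈ s, if f j then v i j else -v i j) +
        ∑ i, w i * Real.cosh (-v i a + ∑ j ∈ s, if f j then v i j else -v i j) =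
        2 * ∑ i, w i * Real.cosh (v i a) *
          Real.cosh (∑ j ∈ s, if f j then v i j else -v i j) := by
      rw [← Finset.sum_add_distrib, Finset.mul_sum]
      refine Finset.sum_congr rfl fun i _ => ?_
      rw [Real.cosh_add, Real.cosh_add, Real.cosh_neg, Real.sinh_neg]
      ring
    linarith

/-- If every row of a nonnegative matrix sums to `1` and its entries are at most `δ`, then some
signing of the columns makes every row sum at most `ε` in absolute value, provided the number
of rows is small compared with `exp (ε ^ 2 / (2 * δ))`. -/
theorem exists_signs_abs_sum_le {ι κ : Type*} [Fintype ι] [Fintype κ] (v : ι → κ → ℝ)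
    {δ ε : ℝ} (hδ : 0 < δ) (hε : 0 < ε) (hv0 : ∀ i j, 0 ≤ v i j) (hvδ : ∀ i j, v i j ≤ δ)
    (hsum : ∀ i, ∑ j, v i j = 1)
    (hcard : 2 * (Fintype.card ι : ℝ) ≤ Real.exp (ε ^ 2 / (2 * δ))) :
    ∃ f : κ → Bool, ∀ i, |∑ j, if f j then v i j else -v i j| ≤ ε := by
  classical
  obtain ⟨f, hf⟩ :=
    exists_signs_sum_cosh_le Finset.univ (fun i j => ε / δ * v i j) (fun _ : ι => 1)
  simp only [one_mul] at hf
  refine ⟨f, fun i => ?_⟩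
  by_contra! hi
  set X := ε ^ 2 / (2 * δ) with hX
  have hprod (i : ι) : ∏ j, Real.cosh (ε / δ * v i j) ≤ Real.exp X := by
    calc ∏ j, Real.cosh (ε / δ * v i j)
        ≤ ∏ j, Real.exp ((ε / δ * v i j) ^ 2 / 2) :=
          Finset.prod_le_prod (fun j _ => (Real.cosh_pos _).le)
            fun j _ => Real.cosh_le_exp_half_sq _
      _ = Real.exp (∑ j, (ε / δ * v i j) ^ 2 / 2) := (Real.exp_sum _ _).symm
      _ ≤ Real.exp X := by
          refine Real.exp_le_exp.2 ?_
          calc ∑ j, (ε / δ * v i j) ^ 2 / 2 ≤ ∑ j, X * v i j := by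
                refine Finset.sum_le_sum fun j _ => ?_
                have : X * v i j - (ε / δ * v i j) ^ 2 / 2 =
                    (ε / δ) ^ 2 / 2 * (v i j * (δ - v i j)) := by
                  rw [hX]; field_simp
                have h2 : 0 ≤ (ε / δ) ^ 2 / 2 * (v i j * (δ - v i j)) :=
                  mul_nonneg (by positivity)
                    (mul_nonneg (hv0 i j) (sub_nonneg.2 (hvδ i j)))
                linarith
            _ = X := by rw [← Finset.mul_sum, hsum, mul_one]
  have hupper : ∑ i, ∏ j, Real.cosh (ε / δ * v i j) ≤ Fintype.card ι * Real.exp X := by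
    simpa using Finset.sum_le_sum fun i (_ : i ∈ Finset.univ) => hprod i
  have hlower : Real.cosh (2 * X) ≤
      ∑ i, Real.cosh (∑ j, if f j then ε / δ * v i j else -(ε / δ * v i j)) := by
    refine le_trans ?_ (Finset.single_le_sum
      (f := fun i => Real.cosh (∑ j, if f j then ε / δ * v i j else -(ε / δ * v i j)))
      (fun i _ => (Real.cosh_pos _).le) (Finset.mem_univ i))
    have hfac : (∑ j, if f j then ε / δ * v i j else -(ε / δ * v i j)) =
        ε / δ * ∑ j, if f j then v i j else -v i j := by
      rw [Finset.mul_sum]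
      refine Finset.sum_congr rfl fun j _ => ?_
      split_ifs <;> ring
    have hpos : 0 < ε / δ := div_pos hε hδ
    have h2X : 2 * X = ε / δ * ε := by rw [hX]; field_simp
    rw [hfac, Real.cosh_le_cosh, h2X, abs_mul, abs_mul, abs_of_pos hpos, abs_of_pos hε]
    exact mul_le_mul_of_nonneg_left hi.le hpos.le
  have hcosh : Real.exp X * Real.exp X / 2 < Real.cosh (2 * X) := by
    rw [Real.cosh_eq, ← Real.exp_add, ← two_mul]
    linarith [Real.exp_pos (-(2 * X))]
  nlinarith [Real.exp_pos X]

/-- A continuous monotone function on `[0, 1]` admits a partition of `[0, 1]` into `K` intervals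
over each of which it grows by the same amount. -/
theorem exists_equipartition {F : ℝ → ℝ} (hF : Continuous F) (hmono : Monotone F) {δ : ℝ}
    (hδ : 0 < δ) {K : ℕ} (hK : 0 < K) (h0 : F 0 = 0) (h1 : F 1 = K * δ) :
    ∃ t : Fin (K + 1) → ℝ, Monotone t ∧ t 0 = 0 ∧ t (Fin.last K) = 1 ∧
      ∀ j, F (t j) = (j : ℕ) * δ := by
  have hex (j : Fin (K + 1)) :
      ∃ x, F x = (j : ℕ) * δ ∧ (j = 0 → x = 0) ∧ (j = Fin.last K → x = 1) := by
    by_cases hj0 : j = 0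
    · refine ⟨0, by simp [hj0, h0], fun _ => rfl, fun h => ?_⟩
      have := congrArg Fin.val (hj0.symm.trans h)
      simp at this
      omega
    by_cases hjK : j = Fin.last K
    · exact ⟨1, by simp [hjK, h1], fun h => absurd h hj0, fun _ => rfl⟩
    have hjle : ((j : ℕ) : ℝ) ≤ K := by exact_mod_cast Nat.lt_succ_iff.1 j.2
    obtain ⟨x, -, hx⟩ := intermediate_value_Icc (zero_le_one' ℝ) hF.continuousOn
      (show ((j : ℕ) : ℝ) * δ ∈ Icc (F 0) (F 1) by
        rw [h0, h1]; exact ⟨by positivity, by gcongr⟩)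
    exact ⟨x, hx, fun h => absurd h hj0, fun h => absurd h hjK⟩
  choose t ht ht0 ht1 using hex
  refine ⟨t, Fin.monotone_iff_le_succ.2 fun j => ?_, ht0 _ rfl, ht1 _ rfl, ht⟩
  by_contra! hlt
  have := hmono hlt.le
  rw [ht, ht] at this
  simp only [Fin.val_castSucc, Fin.val_succ] at this
  push_cast at this
  linarith

/-- The measure of a union of cells of a partition is the sum of the measures of the cells. -/
theorem toReal_measure_biUnion_cells (μ : Measure ℝ) [IsProbabilityMeasure μ] [NullSingletonClass μ] {N : ℕ}
    {t : Fin (N + 1) → ℝ} (ht : Monotone t) (f : Fin N → Bool) (b : Bool) :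
    (μ (⋃ j ∈ {j : Fin N | f j = b}, Icc (t j.castSucc) (t j.succ))).toReal =
      ∑ j, if f j = b then (μ (Icc (t j.castSucc) (t j.succ))).toReal else 0 := by
  have hdisj : Pairwise fun i j : Fin N =>
      AEDisjoint μ (Icc (t i.castSucc) (t i.succ)) (Icc (t j.castSucc) (t j.succ)) := by
    have hlt {i j : Fin N} (hij : i < j) :
        AEDisjoint μ (Icc (t i.castSucc) (t i.succ)) (Icc (t j.castSucc) (t j.succ)) := by
      refine measure_mono_null (t := {t i.succ}) (fun x hx => ?_) (measure_singleton _)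
      exact le_antisymm hx.1.2 ((ht (Fin.succ_le_castSucc_iff.2 hij)).trans hx.2.1)
    intro i j hij
    rcases lt_or_gt_of_ne hij with h | h
    exacts [hlt h, (hlt h).symm]
  have hset : (⋃ j ∈ {j : Fin N | f j = b}, Icc (t j.castSucc) (t j.succ)) =
      ⋃ j ∈ Finset.univ.filter fun j => f j = b, Icc (t j.castSucc) (t j.succ) := by
    simp
  rw [hset, measure_biUnion_finset₀ (fun i _ j _ hij => hdisj hij)
    (fun j _ => measurableSet_Icc.nullMeasurableSet),
    ENNReal.toReal_sum (fun j _ => measure_ne_top _ _), Finset.sum_filter]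

open ProbabilityTheory in
theorem cdf_zero_eq_zero (μ : Measure ℝ) [IsProbabilityMeasure μ] [NullSingletonClass μ]
    (h : μ (Icc 0 1) = 1) : cdf μ 0 = 0 := by
  have hc : μ (Icc (0 : ℝ) 1)ᶜ = 0 := (prob_compl_eq_zero_iff measurableSet_Icc).2 h
  have hIio : μ (Iio (0 : ℝ)) = 0 :=
    measure_mono_null (fun x (hx : x < 0) (hx' : x ∈ Icc 0 1) => not_le_of_gt hx hx'.1) hc
  rw [cdf_eq_real, measureReal_def, ← measure_congr (Iio_ae_eq_Iic (μ := μ) (a := (0 : ℝ))), hIio,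
    ENNReal.toReal_zero]

open ProbabilityTheory in
theorem cdf_one_eq_one (μ : Measure ℝ) [IsProbabilityMeasure μ]
    (h : μ (Icc 0 1) = 1) : cdf μ 1 = 1 := by
  have hIic : μ (Iic (1 : ℝ)) = 1 :=
    le_antisymm prob_le_one (h ▸ measure_mono Icc_subset_Iic_self)
  rw [cdf_eq_real, measureReal_def, hIic, ENNReal.toReal_one]

/-- Existence form of the online ε-Consensus Halving algorithm: `O(n log n / ε²)` cuts
suffice to split `[0,1]` between two agents with every measure's discrepancy at most ε. -/
theorem consensus_halving_many_cuts
    (n : ℕ) (hn : 2 ≤ n) (ε : ℝ) (hε : ε ∈ Set.Ioo (0 : ℝ) 1)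
    (μ : Fin n → Measure ℝ)
    (hprob : ∀ i, IsProbabilityMeasure (μ i))
    (hsupp : ∀ i, μ i (Set.Icc (0 : ℝ) 1) = 1)
    (hna : ∀ i (x : ℝ), μ i {x} = 0) :
    ∃ N : ℕ, N ≤ ⌈(16 * n * Real.logb 2 n / ε ^ 2 : ℝ)⌉₊ + 1 ∧
      ∃ t : Fin (N + 1) → ℝ, Monotone t ∧ t 0 = 0 ∧ t (Fin.last N) = 1 ∧
        ∃ f : Fin N → Bool,
          ∀ i : Fin n,
            |(μ i (⋃ j ∈ {j : Fin N | f j = true}, Set.Icc (t j.castSucc) (t j.succ))).toReal -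
             (μ i (⋃ j ∈ {j : Fin N | f j = false}, Set.Icc (t j.castSucc) (t j.succ))).toReal|
              ≤ ε := by
  obtain ⟨hε0, -⟩ := hε
  have hatoms (i : Fin n) : NullSingletonClass (μ i) := ⟨hna i⟩
  set K := ⌈(16 * n * Real.logb 2 n / ε ^ 2 : ℝ)⌉₊ with hKdef
  have hn2 : (2 : ℝ) ≤ n := by exact_mod_cast hn
  have hn0 : (0 : ℝ) < n := by linarith
  have hlog2 : Real.log 2 ≤ Real.log n := Real.log_le_log two_pos hn2
  have hlog2pos : 0 < Real.log 2 := Real.log_pos one_lt_two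
  have hlogb : Real.log n ≤ Real.logb 2 n := by
    rw [Real.logb, le_div_iff₀ hlog2pos]
    nlinarith [Real.log_two_lt_d9]
  have hlogbpos : 0 < Real.logb 2 n := by linarith
  have hKle : 16 * n * Real.logb 2 n / ε ^ 2 ≤ K := Nat.le_ceil _
  have hK : 0 < K := Nat.ceil_pos.2 (by positivity)
  have hKR : (0 : ℝ) < K := by exact_mod_cast hK
  have hδ : (0 : ℝ) < n / K := by positivity
  obtain ⟨t, htmono, ht0, ht1, htF⟩ := exists_equipartition
    (F := fun x => ∑ i, ProbabilityTheory.cdf (μ i) x)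
    (continuous_finsetSum _ fun i _ => continuous_cdf (μ i))
    (fun x y hxy => Finset.sum_le_sum fun i _ => ProbabilityTheory.monotone_cdf (μ i) hxy)
    hδ hK (by simp [cdf_zero_eq_zero, hsupp])
    (by simp [cdf_one_eq_one, hsupp]; field_simp)
  have hcell (i : Fin n) (j : Fin K) : (μ i (Icc (t j.castSucc) (t j.succ))).toReal =
      ProbabilityTheory.cdf (μ i) (t j.succ) - ProbabilityTheory.cdf (μ i) (t j.castSucc) :=
    toReal_measure_Icc_eq_cdf_sub _ (htmono j.castSucc_lt_succ.le)
  obtain ⟨f, hf⟩ : ∃ f : Fin K → Bool, ∀ i, |∑ j, if f j then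
      (μ i (Icc (t j.castSucc) (t j.succ))).toReal else
      -(μ i (Icc (t j.castSucc) (t j.succ))).toReal| ≤ ε := by
    refine exists_signs_abs_sum_le (fun i (j : Fin K) =>
      (μ i (Icc (t j.castSucc) (t j.succ))).toReal) hδ hε0
      (fun _ _ => ENNReal.toReal_nonneg) (fun i j => ?_) (fun i => ?_) ?_
    · calc (μ i (Icc (t j.castSucc) (t j.succ))).toReal
          ≤ ∑ i, (μ i (Icc (t j.castSucc) (t j.succ))).toReal :=
            Finset.single_le_sum (f := fun i => (μ i (Icc (t j.castSucc) (t j.succ))).toReal)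
              (fun _ _ => ENNReal.toReal_nonneg) (Finset.mem_univ i)
        _ = n / K := by
            simp only [hcell, Finset.sum_sub_distrib, htF, Fin.val_succ, Fin.val_castSucc]
            push_cast
            ring
    · simp only [hcell]
      have htel := Fin.sum_univ_succ (fun j => ProbabilityTheory.cdf (μ i) (t j))
      rw [Fin.sum_univ_castSucc, ht0, ht1, cdf_zero_eq_zero _ (hsupp i),
        cdf_one_eq_one _ (hsupp i)] at htel
      rw [Finset.sum_sub_distrib]
      linarith
    · rw [Fintype.card_fin, ← Real.log_le_iff_le_exp (by positivity),
        Real.log_mul two_ne_zero hn0.ne']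
      have hX : ε ^ 2 / (2 * (n / K)) = ε ^ 2 * K / (2 * n) := by field_simp
      rw [hX, le_div_iff₀ (by positivity)]
      rw [div_le_iff₀ (by positivity)] at hKle
      nlinarith [mul_le_mul_of_nonneg_left hlogb hn0.le, mul_le_mul_of_nonneg_left hlog2 hn0.le]
  refine ⟨K, Nat.le_succ K, t, htmono, ht0, ht1, f, fun i => ?_⟩
  rw [toReal_measure_biUnion_cells _ htmono, toReal_measure_biUnion_cells _ htmono,
    ← Finset.sum_sub_distrib]
  convert hf i using 3 with j
  cases f j <;> simp
end

section
/- Let k ≥ 1 and let m₁, m₂ be positive multiples of k. Consider a cyclic arrangement of m₁ + m₂ beads, each colored with one of two colors, with exactly m₁ beads of color 1. Then there exists a cyclic interval (a set of (m₁ + m₂)/k cyclically consecutive positions) containing exactly m₁/k beads of color 1 (and hence exactly m₂/k beads of color 2). -/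
/-- A sum over `range (k * L)` splits into `k` consecutive blocks of length `L`. -/
theorem sum_range_blocks (f : ℕ → ℤ) (k L : ℕ) :
    ∑ i ∈ Finset.range k, ∑ j ∈ Finset.range L, f (i * L + j) =
      ∑ p ∈ Finset.range (k * L), f p := by
  induction k with
  | zero => simp
  | succ k ih => rw [Finset.sum_range_succ, ih, Nat.succ_mul, Finset.sum_range_add]

/-- A sequence of integers that changes by at most one at each step and avoids the value `t`
on `[0, N)` stays on one side of `t` there. -/
theorem forall_lt_or_forall_gt_of_forall_ne {g : ℕ → ℤ} {t : ℤ} {N : ℕ}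
    (hstep : ∀ s, |g (s + 1) - g s| ≤ 1) (hne : ∀ s < N, g s ≠ t) :
    (∀ s < N, g s < t) ∨ (∀ s < N, t < g s) := by
  rcases lt_or_ge (g 0) t with h | h
  · left
    intro s
    induction s with
    | zero => exact fun _ => h
    | succ s ih =>
      intro hs
      have := ih (by omega)
      have := abs_le.mp (hstep s)
      have := hne _ hs
      omega
  · right
    intro s
    induction s with
    | zero =>
      intro hs
      have := hne _ hs
      omega
    | succ s ih =>
      intro hs
      have := ih (by omega)
      have := abs_le.mp (hstep s)
      have := hne _ hs
      omega

/-- If a sequence with values in `[0, 1]` has total `k * t` over `range (k * L)`, then some window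
of length `L` has sum exactly `t`. -/
theorem exists_window_sum_eq {f : ℕ → ℤ} (hf₀ : ∀ p, 0 ≤ f p) (hf₁ : ∀ p, f p ≤ 1)
    {k L : ℕ} (hk : 0 < k) (hL : 0 < L) {t : ℤ}
    (hsum : ∑ p ∈ Finset.range (k * L), f p = k * t) :
    ∃ s < k * L, ∑ j ∈ Finset.range L, f (s + j) = t := by
  by_contra! hne
  have hstep : ∀ s,
      |∑ j ∈ Finset.range L, f (s + 1 + j) - ∑ j ∈ Finset.range L, f (s + j)| ≤ 1 := by
    intro s
    have h := (Finset.sum_range_succ (fun j => f (s + j)) L).symm.trans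
      (Finset.sum_range_succ' (fun j => f (s + j)) L)
    simp only [add_zero, ← add_assoc] at h
    simp only [add_right_comm s 1]
    have := hf₀ s
    have := hf₁ s
    have := hf₀ (s + L)
    have := hf₁ (s + L)
    rw [abs_le]
    constructor <;> linarith
  have hblocks := (sum_range_blocks f k L).trans hsum
  have hlt : ∀ i ∈ Finset.range k, i * L < k * L := fun i hi =>
    Nat.mul_lt_mul_of_pos_right (Finset.mem_range.mp hi) hL
  have hnonempty : (Finset.range k).Nonempty := Finset.nonempty_range_iff.mpr hk.ne'
  have hconst : ∑ _i ∈ Finset.range k, t = k * t := by simp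
  rcases forall_lt_or_forall_gt_of_forall_ne
    (g := fun s => ∑ j ∈ Finset.range L, f (s + j)) hstep hne with h | h
  · have hlt_sum : ∑ i ∈ Finset.range k, ∑ j ∈ Finset.range L, f (i * L + j) <
        ∑ _i ∈ Finset.range k, t :=
      Finset.sum_lt_sum_of_nonempty hnonempty fun i hi => h (i * L) (hlt i hi)
    exact hlt_sum.ne (hblocks.trans hconst.symm)
  · have hgt_sum : ∑ _i ∈ Finset.range k, t <
        ∑ i ∈ Finset.range k, ∑ j ∈ Finset.range L, f (i * L + j) :=
      Finset.sum_lt_sum_of_nonempty hnonempty fun i hi => h (i * L) (hlt i hi)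
    exact hgt_sum.ne (hconst.trans hblocks.symm)

/-- Discrete intermediate value theorem on a circular two-colored necklace: if `k ∣ m₁`
and `k ∣ m₂`, some cyclic interval of `(m₁+m₂)/k` consecutive beads contains exactly
`m₁/k` beads of color 1 (here color `0` of `Fin 2`). -/
theorem cyclic_interval_exact_count
    (k m₁ m₂ : ℕ) (hk : 1 ≤ k) (h₁ : 0 < m₁) (h₂ : 0 < m₂)
    (hd₁ : k ∣ m₁) (hd₂ : k ∣ m₂)
    (c : ℕ → Fin 2)
    (hc : ((Finset.range (m₁ + m₂)).filter (fun p => c p = 0)).card = m₁) :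
    ∃ s < m₁ + m₂,
      ((Finset.range ((m₁ + m₂) / k)).filter
        (fun j => c ((s + j) % (m₁ + m₂)) = 0)).card = m₁ / k := by
  obtain ⟨a, rfl⟩ := hd₁
  obtain ⟨b, rfl⟩ := hd₂
  have hL : 0 < a + b := by
    have := Nat.pos_of_mul_pos_left h₁
    omega
  rw [← mul_add] at hc ⊢
  rw [Nat.mul_div_cancel_left _ hk, Nat.mul_div_cancel_left _ hk]
  obtain ⟨s, hs, h⟩ := exists_window_sum_eq
    (f := fun p => if c (p % (k * (a + b))) = 0 then 1 else 0) (t := a)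
    (fun p => by split_ifs <;> norm_num)
    (fun p => by split_ifs <;> norm_num) hk hL (by
      rw [← Nat.cast_mul, ← hc, Finset.card_filter, Nat.cast_sum]
      refine Finset.sum_congr rfl fun p hp => ?_
      rw [Nat.mod_eq_of_lt (Finset.mem_range.mp hp)]
      push_cast
      rfl)
  refine ⟨s, hs, ?_⟩
  rw [Finset.card_filter]
  exact_mod_cast h
end

section
/- Let k ≥ 1 and let m₁, m₂ be positive multiples of k. Consider a necklace: a finite sequence of m₁ + m₂ beads on a line, each colored with one of two colors, with exactly m₁ beads of color 1 and m₂ beads of color 2. Then there exists a partition of the beads into at most 2k − 1 intervals of consecutive beads together with an assignment of these intervals to k agents such that every agent receives exactly m₁/k beads of color 1 and exactly m₂/k beads of color 2. (That is, 2k − 2 cuts, which is optimal, suffice for Necklace Splitting with n = 2 colors.) -/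
/-- The order embedding of `ℕ` onto the complement of the window `[s, s + L)`. -/
def skipWindow (s L j : ℕ) : ℕ := if j < s then j else j + L

theorem count_eq_count_skipWindow_add (p : ℕ → Prop) [DecidablePred p] {s N : ℕ} (L : ℕ)
    (hs : s ≤ N) :
    Nat.count p (N + L) =
      Nat.count (fun j => p (skipWindow s L j)) N + Nat.count (fun j => p (s + j)) L := by
  obtain ⟨t, rfl⟩ := Nat.exists_eq_add_of_le hs
  have hleft : Nat.count (fun j => p (skipWindow s L j)) s = Nat.count p s := by
    simp only [Nat.count_eq_card_filter_range]
    congr 1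
    refine Finset.filter_congr fun j hj => ?_
    simp [skipWindow, Finset.mem_range.1 hj]
  have hright : (fun j => p (skipWindow s L (s + j))) = fun j => p (s + L + j) := by
    funext j
    simp [skipWindow, Nat.add_right_comm]
  rw [Nat.add_right_comm, Nat.count_add, Nat.count_add, Nat.count_add _ s t, hleft]
  simp only [hright]
  omega

/-- Discrete intermediate value theorem: if `k * a` of the first `k * L` numbers satisfy `p`,
then some window of length `L` among them contains exactly `a` of them. -/
theorem exists_count_window_eq (p : ℕ → Prop) [DecidablePred p] {k L a : ℕ} (hk : 0 < k)
    (h : Nat.count p (k * L) = k * a) :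
    ∃ s, s + L ≤ k * L ∧ Nat.count (fun j => p (s + j)) L = a := by
  by_contra! hne
  have hadd (s : ℕ) : Nat.count p (s + L) = Nat.count p s + Nat.count (fun j => p (s + j)) L :=
    Nat.count_add ..
  have hstep (n : ℕ) :
      Nat.count p n ≤ Nat.count p (n + 1) ∧ Nat.count p (n + 1) ≤ Nat.count p n + 1 := by
    rw [Nat.count_succ]
    split_ifs <;> omega
  have hblock {j : ℕ} (hj : j < k) : j * L + L ≤ k * L := by
    rw [← Nat.succ_mul]
    exact Nat.mul_le_mul_right L hj
  have hL : 0 + L ≤ k * L := by simpa using hblock hk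
  rcases lt_or_gt_of_ne (hne 0 hL) with h0 | h0
  · have hall (s : ℕ) (hs : s + L ≤ k * L) : Nat.count (fun j => p (s + j)) L < a := by
      induction s with
      | zero => exact h0
      | succ s ih =>
        have h1 := ih (by omega)
        have h2 := hne (s + 1) hs
        have h3 := hadd s
        have h4 := hadd (s + 1)
        have h5 := hstep s
        have h6 := hstep (s + L)
        rw [Nat.add_right_comm] at h4
        omega
    have hsum (j : ℕ) (hj : j ≤ k) : Nat.count p (j * L) + j ≤ j * a := by
      induction j with
      | zero => simp
      | succ j ih =>
        have h1 := ih (by omega)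
        have h2 := hall (j * L) (hblock hj)
        rw [Nat.succ_mul, Nat.succ_mul, hadd]
        omega
    have := hsum k le_rfl
    omega
  · have hall (s : ℕ) (hs : s + L ≤ k * L) : a < Nat.count (fun j => p (s + j)) L := by
      induction s with
      | zero => exact h0
      | succ s ih =>
        have h1 := ih (by omega)
        have h2 := hne (s + 1) hs
        have h3 := hadd s
        have h4 := hadd (s + 1)
        have h5 := hstep s
        have h6 := hstep (s + L)
        rw [Nat.add_right_comm] at h4
        omega
    have hsum (j : ℕ) (hj : j ≤ k) : j * a + j ≤ Nat.count p (j * L) := by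
      induction j with
      | zero => simp
      | succ j ih =>
        have h1 := ih (by omega)
        have h2 := hall (j * L) (hblock hj)
        rw [Nat.succ_mul, Nat.succ_mul, hadd]
        omega
    have := hsum k le_rfl
    omega

theorem count_zero_add_count_one (c : ℕ → Fin 2) (n : ℕ) :
    Nat.count (fun j => c j = 0) n + Nat.count (fun j => c j = 1) n = n := by
  induction n with
  | zero => simp
  | succ n ih =>
    simp only [Nat.count_succ]
    split_ifs <;> omega

/-- Inserting a window with a single value into a sequence creates at most two new changes. -/
theorem card_changes_insert_window_le (g : ℕ → ℕ) {s N : ℕ} (L v : ℕ)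
    (hs : s ≤ N) :
    ((Finset.range (N + L - 1)).filter (fun j =>
      (if j < s then g j else if j < s + L then v else g (j - L)) ≠
        if j + 1 < s then g (j + 1) else if j + 1 < s + L then v else g (j + 1 - L))).card ≤
      ((Finset.range (N - 1)).filter (fun j => g j ≠ g (j + 1))).card + 2 := by
  set S := (Finset.range (N - 1)).filter (fun j => g j ≠ g (j + 1)) with hS
  calc
    _ ≤ (S.image (skipWindow s L) ∪ {s - 1, s + L - 1}).card := by
      refine Finset.card_le_card fun j hj => ?_
      simp only [Finset.mem_filter, Finset.mem_range] at hj
      obtain ⟨hjN, hj⟩ := hj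
      simp only [Finset.mem_union, Finset.mem_insert, Finset.mem_singleton, Finset.mem_image, hS,
        Finset.mem_filter, Finset.mem_range, skipWindow]
      by_contra! hcon
      obtain ⟨himg, h1, h2⟩ := hcon
      rcases lt_or_ge j s with hjs | hjs
      · have hjs' : j + 1 < s := by omega
        rw [if_pos hjs, if_pos hjs'] at hj
        by_cases hjN' : j < N - 1
        · exact himg j ⟨hjN', hj⟩ (if_pos hjs)
        · omega
      · rcases lt_or_ge j (s + L) with hjw | hjw
        · have hjw' : j + 1 < s + L := by omega
          simp [hjs.not_gt, hjw, hjw', show ¬ j + 1 < s by omega] at hj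
        · rw [if_neg (by omega), if_neg (by omega), if_neg (by omega), if_neg (by omega),
            Nat.sub_add_comm (by omega)] at hj
          refine himg (j - L) ⟨by omega, hj⟩ ?_
          rw [if_neg (by omega)]
          omega
    _ ≤ S.card + 2 :=
      (Finset.card_union_le _ _).trans (Nat.add_le_add Finset.card_image_le Finset.card_le_two)

theorem exists_fair_splitting (k a b : ℕ) (c : ℕ → Fin 2)
    (ha : Nat.count (fun j => c j = 0) ((k + 1) * (a + b)) = (k + 1) * a)
    (hb : Nat.count (fun j => c j = 1) ((k + 1) * (a + b)) = (k + 1) * b) :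
    ∃ g : ℕ → ℕ, (∀ j, g j ≤ k) ∧
      ((Finset.range ((k + 1) * (a + b) - 1)).filter (fun j => g j ≠ g (j + 1))).card ≤ 2 * k ∧
      ∀ x ≤ k,
        Nat.count (fun j => g j = x ∧ c j = 0) ((k + 1) * (a + b)) = a ∧
        Nat.count (fun j => g j = x ∧ c j = 1) ((k + 1) * (a + b)) = b := by
  induction k generalizing c with
  | zero =>
    refine ⟨fun _ => 0, by simp, by simp, fun x hx => ?_⟩
    obtain rfl : x = 0 := by omega
    simpa using And.intro ha hb
  | succ k ih =>
    obtain ⟨s, hs, hwa⟩ := exists_count_window_eq _ (Nat.succ_pos _) ha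
    have hwb : Nat.count (fun j => c (s + j) = 1) (a + b) = b := by
      have := count_zero_add_count_one (fun j => c (s + j)) (a + b)
      omega
    set N := (k + 1) * (a + b) with hN
    have hlen : (k + 1 + 1) * (a + b) = N + (a + b) := Nat.succ_mul ..
    rw [hlen] at ha hb hs ⊢
    replace hs : s ≤ N := by omega
    rw [count_eq_count_skipWindow_add _ _ hs, hwa, Nat.succ_mul, Nat.add_right_cancel_iff] at ha
    rw [count_eq_count_skipWindow_add _ _ hs, hwb, Nat.succ_mul, Nat.add_right_cancel_iff] at hb
    obtain ⟨g, hg, hcuts, hfair⟩ := ih (fun j => c (skipWindow s (a + b) j)) ha hb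
    refine ⟨fun j => if j < s then g j else if j < s + (a + b) then k + 1 else g (j - (a + b)),
      fun j => ?_, (card_changes_insert_window_le _ _ _ hs).trans (by omega), fun x hx => ?_⟩
    · have h1 := hg j
      have h2 := hg (j - (a + b))
      dsimp only
      split_ifs <;> omega
    · have hskip (j : ℕ) : (if skipWindow s (a + b) j < s then g (skipWindow s (a + b) j)
          else if skipWindow s (a + b) j < s + (a + b) then k + 1
          else g (skipWindow s (a + b) j - (a + b))) = g j := by
        by_cases hj : j < s
        · simp [skipWindow, hj]
        · simp [skipWindow, hj, show ¬ j + (a + b) < s by omega]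
      have hwindow (y : Fin 2) : Nat.count (fun j => (if s + j < s then g (s + j)
          else if s + j < s + (a + b) then k + 1 else g (s + j - (a + b))) = x ∧ c (s + j) = y)
          (a + b) = Nat.count (fun j => k + 1 = x ∧ c (s + j) = y) (a + b) := by
        simp only [Nat.count_eq_card_filter_range]
        congr 1
        refine Finset.filter_congr fun j hj => ?_
        simp [Finset.mem_range.1 hj]
      rw [count_eq_count_skipWindow_add _ _ hs, count_eq_count_skipWindow_add _ _ hs]
      simp only [hskip, hwindow]
      rcases hx.lt_or_eq with hx | rfl
      · have hne : k + 1 ≠ x := by omega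
        simpa [hne, Nat.count_false] using hfair x (by omega)
      · have hne (j : ℕ) : g j ≠ k + 1 := by have := hg j; omega
        simp [hne, hwa, hwb]

/-- Necklace Splitting with two colors: a necklace with `m₁` beads of color 1 and `m₂` of
color 2 (both multiples of `k`) can be split with `2k−2` cuts (at most `2k−1` intervals of
consecutive beads, recorded by the assignment `g`, the number of intervals being one more
than the number of indices where `g` changes) so that every agent gets exactly `m₁/k`
beads of color 1 and `m₂/k` beads of color 2. -/
theorem necklace_splitting_two_colors
    (k m₁ m₂ : ℕ) (hk : 1 ≤ k) (h₁ : 0 < m₁) (h₂ : 0 < m₂)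
    (hd₁ : k ∣ m₁) (hd₂ : k ∣ m₂)
    (c : ℕ → Fin 2)
    (hc₁ : ((Finset.range (m₁ + m₂)).filter (fun p => c p = 0)).card = m₁)
    (hc₂ : ((Finset.range (m₁ + m₂)).filter (fun p => c p = 1)).card = m₂) :
    ∃ g : ℕ → Fin k,
      ((Finset.range (m₁ + m₂ - 1)).filter (fun j => g j ≠ g (j + 1))).card + 1
        ≤ 2 * k - 1 ∧
      ∀ a : Fin k,
        ((Finset.range (m₁ + m₂)).filter (fun b => g b = a ∧ c b = 0)).card = m₁ / k ∧
        ((Finset.range (m₁ + m₂)).filter (fun b => g b = a ∧ c b = 1)).card = m₂ / k := by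
  obtain ⟨k, rfl⟩ := Nat.exists_eq_add_of_le' hk
  obtain ⟨a, rfl⟩ := hd₁
  obtain ⟨b, rfl⟩ := hd₂
  simp only [← Nat.mul_add, ← Nat.count_eq_card_filter_range,
    Nat.mul_div_cancel_left _ (Nat.succ_pos k)] at hc₁ hc₂ ⊢
  obtain ⟨g, hg, hcuts, hfair⟩ := exists_fair_splitting k a b c hc₁ hc₂
  refine ⟨fun j => ⟨g j, Nat.lt_succ_of_le (hg j)⟩, ?_, fun x => ?_⟩
  · simp only [Nat.count_eq_card_filter_range, ne_eq, Fin.mk.injEq] at hcuts ⊢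
    omega
  · obtain ⟨x, hx⟩ := x
    simp only [Fin.mk.injEq]
    exact hfair x (Nat.le_of_lt_succ hx)
end

section
/- Let n, k ≥ 2, let ε ∈ (0,1), and set g = ε²/(100·k·log₂(nk)). Let a₁, …, a_m be vectors in ℝⁿ such that 0 ≤ a_{j,i} ≤ g for all j ∈ {1,…,m}, i ∈ {1,…,n}, and ∑_{j=1}^{m} a_{j,i} ≤ 1 for every i. Then there exists an assignment f : {1,…,m} → {1,…,k} such that for every pair of distinct agents a, b ∈ {1,…,k}, every measure i ∈ {1,…,n}, and every prefix length t ∈ {1,…,m}, |∑_{j ≤ t, f(j)=a} a_{j,i} − ∑_{j ≤ t, f(j)=b} a_{j,i}| ≤ ε/k. -/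
open Finset in
/-- Moment generating function bound for the effect of a uniformly random recipient on the
difference between agents `p` and `q`. -/
theorem sum_exp_indicator_sub_le {k : ℕ} (hk : 0 < k) (p q : Fin k) {x : ℝ} (hx : |x| ≤ 1) :
    ∑ r : Fin k, Real.exp (x * ((if r = p then 1 else 0) - (if r = q then 1 else 0)))
      ≤ k * Real.exp (2 * x ^ 2 / k) := by
  have hk' : (0 : ℝ) < k := by exact_mod_cast hk
  have hterm : ∀ r : Fin k,
      Real.exp (x * ((if r = p then 1 else 0) - (if r = q then 1 else 0))) ≤
        1 + x * ((if r = p then 1 else 0) - (if r = q then 1 else 0)) +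
          x ^ 2 * ((if r = p then 1 else 0) + (if r = q then 1 else 0)) := by
    intro r
    have h1 := (abs_le.1 (Real.abs_exp_sub_one_sub_id_le hx)).2
    have h2 := (abs_le.1 (Real.abs_exp_sub_one_sub_id_le (x := -x) (by rwa [abs_neg]))).2
    have h3 := sq_nonneg x
    split_ifs <;> simp <;> nlinarith
  calc _ ≤ _ := sum_le_sum fun r _ => hterm r
    _ = k * (2 * x ^ 2 / k + 1) := by
      simp only [sum_add_distrib, ← mul_sum, sum_sub_distrib, sum_ite_eq', mem_univ, if_true,
        sum_const, card_univ, Fintype.card_fin, nsmul_eq_mul]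
      field_simp
      ring
    _ ≤ _ := by gcongr; exact Real.add_one_le_exp _

/-- The sum over ordered pairs of agents and over measures of the exponential potentials of the
assignment `f` after the first `t` intervals. -/
noncomputable def expPotential {n k : ℕ} (b : ℕ → Fin n → ℝ) (l c : ℝ) (f : ℕ → Fin k)
    (t : ℕ) : ℝ :=
  ∑ p : Fin k, ∑ q : Fin k, ∑ i : Fin n, Real.exp (∑ j ∈ Finset.range t,
    (l * b j i * ((if f j = p then 1 else 0) - (if f j = q then 1 else 0)) - c * b j i))

theorem expPotential_congr {n k : ℕ} (b : ℕ → Fin n → ℝ) (l c : ℝ) {f f' : ℕ → Fin k} {t : ℕ}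
    (h : ∀ j < t, f j = f' j) : expPotential b l c f t = expPotential b l c f' t := by
  unfold expPotential
  refine Finset.sum_congr rfl fun p _ => Finset.sum_congr rfl fun q _ =>
    Finset.sum_congr rfl fun i _ => ?_
  congr 1
  refine Finset.sum_congr rfl fun j hj => ?_
  rw [h j (Finset.mem_range.1 hj)]

open Finset in
theorem exists_expPotential_update_le {n k : ℕ} (hk : 0 < k) (b : ℕ → Fin n → ℝ) {l c : ℝ}
    (f : ℕ → Fin k) (t : ℕ) (hl : ∀ i, |l * b t i| ≤ 1)
    (hc : ∀ i, 2 * (l * b t i) ^ 2 / k ≤ c * b t i) :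
    ∃ r, expPotential b l c (Function.update f t r) (t + 1) ≤ expPotential b l c f t := by
  have hne : (univ : Finset (Fin k)).Nonempty := ⟨⟨0, hk⟩, mem_univ _⟩
  suffices h : ∑ r : Fin k, expPotential b l c (Function.update f t r) (t + 1) ≤
      ∑ _r : Fin k, expPotential b l c f t by
    obtain ⟨r, -, hr⟩ := exists_le_of_sum_le hne h
    exact ⟨r, hr⟩
  unfold expPotential
  refine sum_comm.trans_le (le_trans (sum_le_sum fun p _ => ?_) sum_comm.le)
  refine sum_comm.trans_le (le_trans (sum_le_sum fun q _ => ?_) sum_comm.le)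
  refine sum_comm.trans_le (le_trans (sum_le_sum fun i _ => ?_) sum_comm.le)
  set W := ∑ j ∈ range t,
    (l * b j i * ((if f j = p then 1 else 0) - (if f j = q then 1 else 0)) - c * b j i) with hW
  have hstep : ∀ r : Fin k, Real.exp (∑ j ∈ range (t + 1),
      (l * b j i * ((if Function.update f t r j = p then 1 else 0) -
        (if Function.update f t r j = q then 1 else 0)) - c * b j i)) =
      Real.exp (W - c * b t i) *
        Real.exp (l * b t i * ((if r = p then 1 else 0) - (if r = q then 1 else 0))) := by
    intro r
    have hprefix : ∑ j ∈ range t, (l * b j i * ((if Function.update f t r j = p then 1 else 0) -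
        (if Function.update f t r j = q then 1 else 0)) - c * b j i) = W := by
      refine sum_congr rfl fun j hj => ?_
      rw [Function.update_of_ne (mem_range.1 hj).ne]
    rw [sum_range_succ, hprefix, Function.update_self, ← Real.exp_add]
    congr 1
    ring
  simp only [hstep, ← mul_sum, sum_const, card_univ, Fintype.card_fin, nsmul_eq_mul]
  calc _ ≤ Real.exp (W - c * b t i) * (k * Real.exp (2 * (l * b t i) ^ 2 / k)) := by
        gcongr
        exact sum_exp_indicator_sub_le hk p q (hl i)
    _ ≤ Real.exp (W - c * b t i) * (k * Real.exp (c * b t i)) := by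
        gcongr
        exact hc i
    _ = k * Real.exp W := by
        rw [mul_left_comm, ← Real.exp_add, sub_add_cancel]

/-- Greedy choice keeps the potential below its initial value. -/
theorem exists_expPotential_le {n k : ℕ} (hk : 0 < k) (b : ℕ → Fin n → ℝ) {l c : ℝ}
    (hl : ∀ j i, |l * b j i| ≤ 1) (hc : ∀ j i, 2 * (l * b j i) ^ 2 / k ≤ c * b j i) (m : ℕ) :
    ∃ f : ℕ → Fin k, ∀ t ≤ m, expPotential b l c f t ≤ k * (k * n) := by
  induction m with
  | zero =>
    refine ⟨fun _ => ⟨0, hk⟩, fun t ht => ?_⟩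
    obtain rfl := Nat.le_zero.1 ht
    simp [expPotential]
  | succ m ih =>
    obtain ⟨f, hf⟩ := ih
    obtain ⟨r, hr⟩ := exists_expPotential_update_le hk b f m (hl m) (hc m)
    refine ⟨Function.update f m r, fun t ht => ?_⟩
    rcases Nat.le_succ_iff.1 ht with h | rfl
    · rw [expPotential_congr b l c fun j hj => Function.update_of_ne (hj.trans_le h).ne r f]
      exact hf t h
    · exact hr.trans (hf m le_rfl)

theorem exp_le_expPotential {n k : ℕ} (b : ℕ → Fin n → ℝ) (l c : ℝ) (f : ℕ → Fin k) (t : ℕ)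
    (p q : Fin k) (i : Fin n) :
    Real.exp (∑ j ∈ Finset.range t,
      (l * b j i * ((if f j = p then 1 else 0) - (if f j = q then 1 else 0)) - c * b j i)) ≤
      expPotential b l c f t := by
  unfold expPotential
  refine le_trans ?_ (Finset.single_le_sum (fun p _ => by positivity) (Finset.mem_univ p))
  refine le_trans ?_ (Finset.single_le_sum (fun q _ => by positivity) (Finset.mem_univ q))
  exact Finset.single_le_sum (f := fun i => Real.exp (∑ j ∈ Finset.range t,
      (l * b j i * ((if f j = p then 1 else 0) - (if f j = q then 1 else 0)) - c * b j i)))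
    (fun i _ => by positivity) (Finset.mem_univ i)

open Finset in
theorem sum_filter_lt_eq_sum_range {m t : ℕ} (ht : t ≤ m) (P : ℕ → Prop) [DecidablePred P]
    (v : ℕ → ℝ) :
    ∑ j ∈ univ.filter (fun j : Fin m => (j : ℕ) < t ∧ P j), v j =
      ∑ j ∈ range t, v j * (if P j then 1 else 0) := by
  rw [sum_filter, ← sum_range (fun j => if j < t ∧ P j then v j else 0), ← sum_filter]
  simp only [mul_ite, mul_one, mul_zero]
  rw [← sum_filter]
  congr 1
  ext j
  simp only [mem_filter, mem_range]
  constructor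
  · exact fun h => h.2
  · exact fun h => ⟨h.1.trans_le ht, h⟩


/-- Combinatorial core of the online ε-Consensus Splitting algorithm with `k` agents:
if every interval has each measure at most `g = ε²/(100 k log₂(nk))` and each measure
totals at most 1, the intervals can be assigned to `k` agents so that after every prefix
every two agents' shares of every measure differ by at most `ε/k`. -/
theorem online_k_agent_assignment
    (n k m : ℕ) (hn : 2 ≤ n) (hk : 2 ≤ k) (ε : ℝ) (hε : ε ∈ Set.Ioo (0 : ℝ) 1)
    (a : Fin m → Fin n → ℝ)
    (hbd : ∀ j i, a j i ∈ Set.Icc (0 : ℝ) (ε ^ 2 / (100 * k * Real.logb 2 (n * k))))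
    (hsum : ∀ i, ∑ j, a j i ≤ 1) :
    ∃ f : Fin m → Fin k,
      ∀ (p q : Fin k), p ≠ q → ∀ (i : Fin n) (t : ℕ), t ≤ m →
        |∑ j ∈ Finset.univ.filter (fun j : Fin m => (j : ℕ) < t ∧ f j = p), a j i -
         ∑ j ∈ Finset.univ.filter (fun j : Fin m => (j : ℕ) < t ∧ f j = q), a j i|
          ≤ ε / k := by
  obtain ⟨hε0, hε1⟩ := hε
  have hn0 : (2 : ℝ) ≤ n := by exact_mod_cast hn
  have hk0 : (2 : ℝ) ≤ k := by exact_mod_cast hk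
  have hnk : (4 : ℝ) ≤ n * k := by nlinarith
  set L := Real.logb 2 (n * k) with hL
  have hL0 : 0 < L := Real.logb_pos (by norm_num) (by linarith)
  have hlogL : Real.log (n * k) ≤ L := by
    rw [hL, Real.logb, le_div_iff₀ (Real.log_pos (by norm_num))]
    have := Real.log_pos (show (1 : ℝ) < n * k by linarith)
    have := Real.log_two_lt_d9
    nlinarith
  set g := ε ^ 2 / (100 * k * L) with hg
  set l := 25 * k * L / ε with hldef
  set c := 25 * L / 2 with hcdef
  have hl0 : 0 < l := by positivity
  have hlg : l * g = ε / 4 := by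
    rw [hldef, hg]; field_simp; norm_num
  have hcl : 2 * l * (l * g) / k = c := by
    rw [hlg, hldef, hcdef]; field_simp; norm_num
  set b : ℕ → Fin n → ℝ := fun j i => if h : j < m then a ⟨j, h⟩ i else 0 with hb
  have hg0 : 0 ≤ g := by positivity
  have hb_mem : ∀ j i, 0 ≤ b j i ∧ b j i ≤ g := by
    intro j i
    simp only [hb]
    split_ifs with h
    · exact hbd ⟨j, h⟩ i
    · exact ⟨le_rfl, hg0⟩
  have hb_val : ∀ (j : Fin m) i, b j i = a j i := fun j i => by simp [hb]
  have hb_sum : ∀ i, ∀ t ≤ m, ∑ j ∈ Finset.range t, b j i ≤ 1 := by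
    intro i t ht
    refine le_trans (Finset.sum_le_sum_of_subset_of_nonneg
      (Finset.range_mono ht) fun j _ _ => (hb_mem j i).1) ?_
    rw [Finset.sum_range]
    simpa only [hb_val] using hsum i
  obtain ⟨f, hf⟩ := exists_expPotential_le (k := k) (by omega) b (l := l) (c := c)
    (fun j i => by
      obtain ⟨h0, h1⟩ := hb_mem j i
      rw [abs_of_nonneg (by positivity)]
      nlinarith [mul_le_mul_of_nonneg_left h1 hl0.le])
    (fun j i => by
      obtain ⟨h0, h1⟩ := hb_mem j i
      calc 2 * (l * b j i) ^ 2 / k = 2 * l * (l * b j i) / k * b j i := by ring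
        _ ≤ 2 * l * (l * g) / k * b j i := by gcongr
        _ = c * b j i := by rw [hcl]) m
  have key : ∀ (p q : Fin k) (i : Fin n) (t : ℕ), t ≤ m →
      ∑ j ∈ Finset.range t, b j i * (if f j = p then 1 else 0) -
        ∑ j ∈ Finset.range t, b j i * (if f j = q then 1 else 0) ≤ ε / k := by
    intro p q i t ht
    have h1 := (exp_le_expPotential b l c f t p q i).trans (hf t ht)
    have h2 : (k : ℝ) * (k * n) ≤ Real.exp (2 * L) := by
      have h : (k : ℝ) ≤ n * k := by nlinarith
      calc (k : ℝ) * (k * n) = k * (n * k) := by ring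
        _ ≤ (n * k) * (n * k) := by gcongr
        _ = Real.exp (Real.log (n * k) + Real.log (n * k)) := by
          rw [Real.exp_add, Real.exp_log (by linarith)]
        _ ≤ _ := Real.exp_le_exp.2 (by linarith)
    have h3 := Real.exp_le_exp.1 (h1.trans h2)
    have h4 : ∑ j ∈ Finset.range t, (l * b j i *
        ((if f j = p then 1 else 0) - (if f j = q then 1 else 0)) - c * b j i) =
        l * (∑ j ∈ Finset.range t, b j i * (if f j = p then 1 else 0) -
        ∑ j ∈ Finset.range t, b j i * (if f j = q then 1 else 0)) -
          c * ∑ j ∈ Finset.range t, b j i := by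
      rw [← Finset.sum_sub_distrib, Finset.mul_sum, Finset.mul_sum, ← Finset.sum_sub_distrib]
      exact Finset.sum_congr rfl fun j _ => by ring
    rw [h4] at h3
    have h5 : l * (ε / k) = 25 * L := by rw [hldef]; field_simp
    have h6 : c * ∑ j ∈ Finset.range t, b j i ≤ c * 1 := by
      gcongr
      exact hb_sum i t ht
    refine le_of_mul_le_mul_left ?_ hl0
    rw [h5]
    linarith
  refine ⟨fun j => f j, fun p q _ i t ht => ?_⟩
  have hshare : ∀ p : Fin k,
      ∑ j ∈ Finset.univ.filter (fun j : Fin m => (j : ℕ) < t ∧ f j = p), a j i =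
        ∑ j ∈ Finset.range t, b j i * (if f j = p then 1 else 0) := fun p => by
    rw [← sum_filter_lt_eq_sum_range ht (fun j => f j = p) (fun j => b j i)]
    simp only [hb_val]
  rw [hshare p, hshare q, abs_sub_le_iff]
  exact ⟨key p q i t ht, key q p i t ht⟩
end
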